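/- arXiv:2203.06656 — 4 statements merged into one kernel-verified Lean document; each statement's English description precedes it below -/
import Mathlib

section
/- VC dimension of sparse ReLU networks (Proposition 3, Section 6). Fix d,L,p∈ℕ* and a sparsity indicator vector s∈{0,1}^{p̄} with p̄ = p²(L−1)+p(L+d+1)+1. Let S̄_{(L,p,s)} be the class of functions on [0,1]^d computed by ReLU networks f(w)=M_L∘σ∘M_{L−1}∘···∘σ∘M_0(w), where σ(x)=max(0,x) acts componentwise, M_l(y)=A_l y+b_l with A_0 of size p×d, A_l of size p×p for 1≤l≤L−1, A_L of size 1×p, b_l∈ℝ^p for 0≤l≤L−1 and b_L∈ℝ, and where each parameter (entry of some A_l or b_l) is allowed to vary in ℝ if the corresponding component of s equals 1 and is fixed to 0 otherwise. Then S̄_{(L,p,s)} is a VC-subgraph class on [0,1]^d with dimension V_{(L,p,s)} ≤ (L+1)(‖s‖₀+1)·log₂[2·(2e(L+1)(pL/2+1))²], where ‖s‖₀ is the number of nonzero components of s. -/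
/-- The unit cube `[0,1]^d`. -/
def unitCube (d : ℕ) : Set (Fin d → ℝ) := {w | ∀ j, w j ∈ Set.Icc (0:ℝ) 1}

/-- A class `F` of real-valued functions on `W` is VC-subgraph on the domain `D ⊆ W` with
dimension not larger than `V`: no finite set of points of `D × ℝ` of cardinality exceeding
`V` is shattered by the open subgraphs `{(w,t) : t < f(w)}`, `f ∈ F`. -/
def VCSubgraphLEOn {W : Type*} (D : Set W) (F : Set (W → ℝ)) (V : ℝ) : Prop :=
  ∀ S : Finset (W × ℝ), (∀ q ∈ S, q.1 ∈ D) → (S.card : ℝ) > V →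
    ∃ S' ⊆ S, ∀ f ∈ F, (↑S' : Set (W × ℝ)) ≠ (↑S : Set (W × ℝ)) ∩ {q : W × ℝ | q.2 < f q.1}

/-- The function computed by a ReLU network `f = M_L ∘ σ ∘ M_{L−1} ∘ ⋯ ∘ σ ∘ M_0`,
on input dimension `d`, width `p` and depth `L`, with first-layer weights `A0, b0`,
hidden-layer weights `Ah l, bh l` (for `l = 1, …, L−1`) and output-layer weights
`AL, bL`; `σ(x) = max(x,0)` acts componentwise. -/
noncomputable def nnForward (d p L : ℕ)
    (A0 : Fin p → Fin d → ℝ) (b0 : Fin p → ℝ)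
    (Ah : Fin (L - 1) → Fin p → Fin p → ℝ) (bh : Fin (L - 1) → Fin p → ℝ)
    (AL : Fin p → ℝ) (bL : ℝ) (w : Fin d → ℝ) : ℝ :=
  let h : ℕ → Fin p → ℝ := fun k =>
    Nat.rec (motive := fun _ => Fin p → ℝ)
      (fun i => (∑ j, A0 i j * w j) + b0 i)
      (fun k ih =>
        if hk : k < L - 1 then
          fun i => (∑ j, Ah ⟨k, hk⟩ i j * max (ih j) 0) + bh ⟨k, hk⟩ i
        else ih) k
  (∑ j, AL j * max (h (L - 1) j) 0) + bL

/-- The class `S̄_{(L,p,s)}` of sparse ReLU networks on `[0,1]^d` of depth `L` and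
width `p`, with all parameters in `paramSet` and with the parameters at the positions
where the sparsity masks (`mA0, mb0, mAh, mbh, mAL, mbL`) vanish fixed to `0`. -/
def sparseNNClass (d p L : ℕ) (paramSet : Set ℝ)
    (mA0 : Fin p → Fin d → Bool) (mb0 : Fin p → Bool)
    (mAh : Fin (L - 1) → Fin p → Fin p → Bool) (mbh : Fin (L - 1) → Fin p → Bool)
    (mAL : Fin p → Bool) (mbL : Bool) : Set ((Fin d → ℝ) → ℝ) :=
  {f | ∃ (A0 : Fin p → Fin d → ℝ) (b0 : Fin p → ℝ)
        (Ah : Fin (L - 1) → Fin p → Fin p → ℝ) (bh : Fin (L - 1) → Fin p → ℝ)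
        (AL : Fin p → ℝ) (bL : ℝ),
      (∀ i j, A0 i j ∈ paramSet) ∧ (∀ i, b0 i ∈ paramSet) ∧
      (∀ l i j, Ah l i j ∈ paramSet) ∧ (∀ l i, bh l i ∈ paramSet) ∧
      (∀ i, AL i ∈ paramSet) ∧ bL ∈ paramSet ∧
      (∀ i j, mA0 i j = false → A0 i j = 0) ∧ (∀ i, mb0 i = false → b0 i = 0) ∧
      (∀ l i j, mAh l i j = false → Ah l i j = 0) ∧
      (∀ l i, mbh l i = false → bh l i = 0) ∧
      (∀ i, mAL i = false → AL i = 0) ∧ (mbL = false → bL = 0) ∧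
      f = nnForward d p L A0 b0 Ah bh AL bL}

/-- The number `‖s‖₀` of nonzero components of the sparsity pattern. -/
def maskZeroNorm (d p L : ℕ)
    (mA0 : Fin p → Fin d → Bool) (mb0 : Fin p → Bool)
    (mAh : Fin (L - 1) → Fin p → Fin p → Bool) (mbh : Fin (L - 1) → Fin p → Bool)
    (mAL : Fin p → Bool) (mbL : Bool) : ℕ :=
  (Finset.univ.filter (fun q : Fin p × Fin d => mA0 q.1 q.2)).card
    + (Finset.univ.filter (fun i : Fin p => mb0 i)).card
    + (Finset.univ.filter (fun q : Fin (L - 1) × Fin p × Fin p => mAh q.1 q.2.1 q.2.2)).card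
    + (Finset.univ.filter (fun q : Fin (L - 1) × Fin p => mbh q.1 q.2)).card
    + (Finset.univ.filter (fun i : Fin p => mAL i)).card
    + (if mbL then 1 else 0)

theorem sum_range_multichoose (n M : ℕ) :
    ∑ k ∈ Finset.range (M + 1), n.multichoose k = (n + 1).multichoose M := by
  induction M with
  | zero => simp
  | succ M ih => rw [Finset.sum_range_succ, ih, Nat.multichoose_succ_succ, add_comm]

theorem finrank_restrictTotalDegree (ι : Type*) [Fintype ι] (K : Type*) [Field K] (M : ℕ) :
    Module.finrank K (MvPolynomial.restrictTotalDegree ι K M) =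
      (Fintype.card ι + M).choose (Fintype.card ι) := by
  classical
  rw [MvPolynomial.restrictTotalDegree,
    Module.finrank_eq_nat_card_basis (MvPolynomial.basisRestrictSupport K _)]
  have h : {s : ι →₀ ℕ | (s.sum fun _ e => e) ≤ M} =
      ((Finset.range (M + 1)).biUnion fun k => Finset.univ.finsuppAntidiag k : Finset (ι →₀ ℕ)) := by
    ext s
    simp [Finset.mem_finsuppAntidiag, Finsupp.sum_fintype]
  rw [Nat.card_coe_set_eq, h, Set.ncard_coe_finset, Finset.card_biUnion]
  · simp_rw [Finset.card_finsuppAntidiag_nat_eq_multichoose]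
    rw [sum_range_multichoose, Nat.multichoose_eq, Finset.card_univ]
    rw [show Fintype.card ι + 1 + M - 1 = Fintype.card ι + M by omega,
      Nat.choose_symm_add]
  · intro a _ b _ hab
    rw [Function.onFun, Finset.disjoint_left]
    intro s hs hs'
    rw [Finset.mem_finsuppAntidiag] at hs hs'
    exact hab (hs.1.symm.trans hs'.1)

open Filter Topology in
theorem exists_choose_lt_mul_choose (n E B : ℕ) (hB : E ^ n ≤ B) :
    ∃ M, (n + (E * M + B)).choose n < (B + 1) * (n + M).choose n := by
  have h1 (i : ℕ) : Tendsto (fun M : ℕ => ((E * M + B + 1 + i : ℕ) : ℝ) / ((M + 1 + i : ℕ) : ℝ))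
      atTop (𝓝 E) := by
    have h0 : Tendsto (fun M : ℕ => (M : ℝ) + (1 + i)) atTop atTop :=
      tendsto_atTop_add_const_right _ _ tendsto_natCast_atTop_atTop
    have h2 : Tendsto (fun M : ℕ => (E : ℝ) + ((B + 1 + i - E * (1 + i) : ℝ)) / ((M : ℝ) + (1 + i)))
        atTop (𝓝 (E + 0)) := tendsto_const_nhds.add (h0.const_div_atTop _)
    rw [add_zero] at h2
    refine h2.congr fun M => ?_
    have : (M : ℝ) + (1 + i) ≠ 0 := by positivity
    push_cast
    field_simp
    ring
  have h2 : Tendsto (fun M : ℕ => ∏ i ∈ Finset.range n,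
      (((E * M + B + 1 + i : ℕ) : ℝ) / ((M + 1 + i : ℕ) : ℝ))) atTop (𝓝 ((E : ℝ) ^ n)) := by
    simpa using tendsto_finsetProd (Finset.range n) fun i _ => h1 i
  have h3 : (E : ℝ) ^ n < B + 1 := by exact_mod_cast Nat.lt_succ_of_le hB
  obtain ⟨M, hM⟩ := (h2.eventually_lt_const h3).exists
  refine ⟨M, ?_⟩
  have key (a : ℕ) : ∏ i ∈ Finset.range n, (((a + 1 + i : ℕ) : ℝ)) = n.factorial * (n + a).choose n := by
    rw [← Nat.cast_prod, ← Nat.ascFactorial_eq_prod_range, add_comm n a,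
      Nat.ascFactorial_eq_factorial_mul_choose]
    simp
  rw [Finset.prod_div_distrib, key, key, div_lt_iff₀ (by
    have := Nat.choose_pos (Nat.le_add_right n M); positivity)] at hM
  have hf : (0 : ℝ) < n.factorial := by positivity
  have : (((n + (E * M + B)).choose n : ℕ) : ℝ) < ((B + 1 : ℕ) : ℝ) * ((n + M).choose n : ℕ) := by
    refine lt_of_mul_lt_mul_left (a := (n.factorial : ℝ)) ?_ hf.le
    calc _ < _ := hM
      _ = _ := by push_cast; ring
  exact_mod_cast this

open MvPolynomial

theorem totalDegree_aeval_le {ι τ R : Type*} [Fintype τ] [CommRing R] (Φ : τ → MvPolynomial ι R)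
    {E M : ℕ} (hΦ : ∀ i, (Φ i).totalDegree ≤ E) (P : MvPolynomial τ R) (hP : P.totalDegree ≤ M) :
    (aeval Φ P).totalDegree ≤ E * M := by
  rw [aeval_def, eval₂_eq]
  refine totalDegree_finsetSum_le fun s hs => ?_
  refine (totalDegree_mul _ _).trans ?_
  rw [algebraMap_eq, totalDegree_C, zero_add]
  refine (totalDegree_finsetProd _ _).trans ?_
  calc ∑ i ∈ s.support, (Φ i ^ s i).totalDegree ≤ ∑ i ∈ s.support, s i * E :=
        Finset.sum_le_sum fun i _ => (totalDegree_pow _ _).trans (Nat.mul_le_mul_left _ (hΦ i))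
    _ = E * s.degree := by rw [← Finset.sum_mul, mul_comm]; rfl
    _ ≤ E * M := Nat.mul_le_mul_left _ ((le_totalDegree hs).trans hP)

theorem exists_annihilating_family {ι K : Type*} [Fintype ι] [Field K] (Φ : ι → MvPolynomial ι K)
    (E : ℕ) (hΦ : ∀ i, (Φ i).totalDegree ≤ E) (t : MvPolynomial ι K) (ht : t.totalDegree ≤ 1) :
    ∃ P : Fin (E ^ Fintype.card ι + 1) → MvPolynomial ι K, P ≠ 0 ∧
      ∑ b, aeval Φ (P b) * t ^ (b : ℕ) = 0 := by
  set B := E ^ Fintype.card ι with hB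
  obtain ⟨M, hM⟩ := exists_choose_lt_mul_choose (Fintype.card ι) E B le_rfl
  let T : (Fin (B + 1) → restrictTotalDegree ι K M) →ₗ[K] MvPolynomial ι K :=
    ∑ b : Fin (B + 1), (LinearMap.mulRight K (t ^ (b : ℕ))) ∘ₗ (aeval Φ).toLinearMap ∘ₗ
      (restrictTotalDegree ι K M).subtype ∘ₗ LinearMap.proj b
  have hT (P) : T P = ∑ b, aeval Φ (P b : MvPolynomial ι K) * t ^ (b : ℕ) := by simp [T]
  have hTmem (P) : T P ∈ restrictTotalDegree ι K (E * M + B) := by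
    rw [hT]
    refine Submodule.sum_mem _ fun b _ => ?_
    rw [mem_restrictTotalDegree]
    refine (totalDegree_mul _ _).trans (Nat.add_le_add
      (totalDegree_aeval_le Φ hΦ _ ((mem_restrictTotalDegree _ _ _).1 (P b).2)) ?_)
    calc _ ≤ (b : ℕ) * t.totalDegree := totalDegree_pow _ _
      _ ≤ b * 1 := Nat.mul_le_mul_left _ ht
      _ ≤ B := by have := b.2; omega
  have hker : LinearMap.ker (T.codRestrict _ hTmem) ≠ ⊥ := by
    apply LinearMap.ker_ne_bot_of_finrank_lt
    rw [Module.finrank_pi_fintype]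
    simpa [finrank_restrictTotalDegree] using hM
  obtain ⟨P, hP, hP0⟩ := Submodule.exists_mem_ne_zero_of_ne_bot hker
  refine ⟨fun b => P b, fun h => hP0 ?_, ?_⟩
  · ext1 b
    exact Subtype.ext (congrFun h b)
  · rw [← hT]
    simpa [Subtype.ext_iff] using hP

theorem exists_separating_moment_form {ι K : Type*} [Fintype ι] [Field K] [CharZero K]
    (T : Finset (ι → K)) :
    ∃ s < T.card * T.card * Fintype.card ι + 1, Set.InjOn
      (fun x : ι → K => ∑ j, (s : K) ^ (Fintype.equivFin ι j : ℕ) * x j) T := by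
  classical
  let g : (ι → K) × (ι → K) → Polynomial K := fun q =>
    ∑ j, Polynomial.C (q.1 j - q.2 j) * Polynomial.X ^ (Fintype.equivFin ι j : ℕ)
  have hg : ∀ q ∈ T.offDiag, g q ≠ 0 := by
    intro q hq h0
    refine (Finset.mem_offDiag.1 hq).2.2 (funext fun i => ?_)
    have h := congrArg (fun r => Polynomial.coeff r (Fintype.equivFin ι i : ℕ)) h0
    simp only [g, Polynomial.finsetSum_coeff, Polynomial.coeff_C_mul_X_pow, Polynomial.coeff_zero,
      Fin.val_inj, EmbeddingLike.apply_eq_iff_eq, Finset.sum_ite_eq, Finset.mem_univ, if_true] at h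
    exact sub_eq_zero.1 h
  have hdeg : ∀ q, (g q).natDegree ≤ Fintype.card ι := fun q =>
    Polynomial.natDegree_sum_le_of_forall_le _ _ fun j _ =>
      (Polynomial.natDegree_C_mul_X_pow_le _ _).trans (Fintype.equivFin ι j).2.le
  have hprod : (∏ q ∈ T.offDiag, g q).natDegree < T.card * T.card * Fintype.card ι + 1 := by
    refine Nat.lt_succ_of_le ((Polynomial.natDegree_prod_le _ _).trans ?_)
    refine (Finset.sum_le_card_nsmul _ _ _ fun q _ => hdeg q).trans ?_
    rw [smul_eq_mul, Finset.offDiag_card]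
    exact Nat.mul_le_mul_right _ (Nat.sub_le _ _)
  by_contra! hcon
  refine Finset.prod_ne_zero_iff.2 hg (Polynomial.eq_zero_of_natDegree_lt_card_of_eval_eq_zero
    _ (f := fun i : Fin (T.card * T.card * Fintype.card ι + 1) => ((i : ℕ) : K))
    (fun a b h => Fin.ext (Nat.cast_injective h)) (fun i => ?_) (by simpa using hprod))
  have h := hcon i i.2
  simp only [Set.InjOn, not_forall] at h
  obtain ⟨x, hx, y, hy, hxy, hne⟩ := h
  rw [Polynomial.eval_prod]
  refine Finset.prod_eq_zero (Finset.mem_offDiag.2 ⟨hx, hy, hne⟩ : (x, y) ∈ T.offDiag) ?_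
  have := sub_eq_zero.2 hxy
  rw [← Finset.sum_sub_distrib] at this
  rw [Polynomial.eval_finsetSum, ← this]
  exact Finset.sum_congr rfl fun j _ => by simp; ring

/-- Generic fibres of a polynomial self-map of affine `n`-space whose components have degree at
most `E` have at most `E ^ n` points. -/
theorem exists_ne_zero_forall_fiber_card_le {ι K : Type*} [Fintype ι] [Field K] [CharZero K]
    (Φ : ι → MvPolynomial ι K) (E : ℕ) (hΦ : ∀ i, (Φ i).totalDegree ≤ E) :
    ∃ Q : MvPolynomial ι K, Q ≠ 0 ∧ ∀ a, eval a Q ≠ 0 → ∀ T : Finset (ι → K),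
      (∀ x ∈ T, ∀ i, eval x (Φ i) = a i) → T.card ≤ E ^ Fintype.card ι := by
  classical
  let t : ℕ → MvPolynomial ι K := fun s =>
    ∑ j, C ((s : K) ^ (Fintype.equivFin ι j : ℕ)) * X j
  have ht (s) : (t s).totalDegree ≤ 1 := totalDegree_finsetSum_le fun j _ =>
    (totalDegree_mul _ _).trans (by rw [totalDegree_C, totalDegree_X])
  have hann := fun s => exists_annihilating_family Φ E hΦ (t s) (ht s)
  generalize hN : E ^ Fintype.card ι + 1 = N at hann
  choose P hP0 hP using hann
  choose b hb using fun s => Function.ne_iff.1 (hP0 s)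
  refine ⟨∏ s ∈ Finset.range (N * N * Fintype.card ι + 1), P s (b s),
    Finset.prod_ne_zero_iff.2 fun s _ => hb s, fun a ha T hT => ?_⟩
  by_contra! hcard
  obtain ⟨T', hT', hcard'⟩ := Finset.exists_subset_card_eq (hN.ge.trans (Nat.succ_le_of_lt hcard))
  obtain ⟨s, hs, hinj⟩ := exists_separating_moment_form T'
  rw [hcard'] at hs
  rw [map_prod, Finset.prod_ne_zero_iff] at ha
  have has := ha s (Finset.mem_range.2 hs)
  let r : Polynomial K := ∑ c : Fin N, Polynomial.C (eval a (P s c)) * Polynomial.X ^ (c : ℕ)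
  have hr : r ≠ 0 := by
    intro h0
    have h := congrArg (fun r => Polynomial.coeff r (b s : ℕ)) h0
    simp only [r, Polynomial.finsetSum_coeff, Polynomial.coeff_C_mul_X_pow, Polynomial.coeff_zero,
      Fin.val_inj, Finset.sum_ite_eq, Finset.mem_univ, if_true] at h
    exact has h
  have hdeg : r.natDegree < N := by
    rw [← hN, Nat.lt_succ_iff]
    refine Polynomial.natDegree_sum_le_of_forall_le _ _ fun c _ =>
      (Polynomial.natDegree_C_mul_X_pow_le _ _).trans (by have := c.2; omega)
  refine hr (Polynomial.eq_zero_of_natDegree_lt_card_of_eval_eq_zero' r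
    (T'.image fun x => eval x (t s)) ?_ ?_)
  · intro y hy
    obtain ⟨x, hx, rfl⟩ := Finset.mem_image.1 hy
    have h := congrArg (eval x) (hP s)
    have hxa : (fun i => eval x (Φ i)) = a := funext (hT x (hT' hx))
    have hcomp (R : MvPolynomial ι K) : eval x (aeval Φ R) = eval a R := by
      rw [← hxa, ← coe_aeval_eq_eval, ← coe_aeval_eq_eval, RingHom.coe_coe, RingHom.coe_coe,
        ← AlgHom.comp_apply, comp_aeval]
    simpa only [r, Polynomial.eval_finsetSum, map_sum, map_mul, map_pow, hcomp, map_zero,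
      Polynomial.eval_mul, Polynomial.eval_pow, Polynomial.eval_C, Polynomial.eval_X] using h
  · rw [Finset.card_image_of_injOn, hcard']
    · exact hdeg
    · intro x hx y hy hxy
      refine hinj hx hy ?_
      simpa [t] using hxy

theorem totalDegree_pderiv_le {ι R : Type*} [CommRing R] (j : ι) (p : MvPolynomial ι R) :
    (pderiv j p).totalDegree ≤ p.totalDegree := by
  classical
  conv_lhs => rw [p.as_sum, map_sum]
  refine totalDegree_finsetSum_le fun s hs => ?_
  rw [pderiv_monomial]
  refine (totalDegree_monomial_le _ _).trans (le_trans ?_ (le_totalDegree hs))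
  exact Finsupp.degree_mono (tsub_le_self (a := s) (b := Finsupp.single j 1))

theorem hasDerivAt_eval_update {ι : Type*} [DecidableEq ι] (x : ι → ℝ) (j : ι)
    (p : MvPolynomial ι ℝ) (t : ℝ) :
    HasDerivAt (fun t => eval (Function.update x j t) p)
      (eval (Function.update x j t) (pderiv j p)) t := by
  induction p using MvPolynomial.induction_on with
  | C r => simpa using hasDerivAt_const t r
  | add p q hp hq => simpa using! hp.add hq
  | mul_X p i hp =>
    have hX : HasDerivAt (fun t => Function.update x j t i) (Pi.single (M := fun _ => ℝ) j 1 i) t := by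
      rcases eq_or_ne i j with rfl | hij
      · simpa using hasDerivAt_id' t
      · simpa [hij] using hasDerivAt_const t (x i)
    convert! hp.mul hX using 1
    · ext t
      simp
    · simp [pderiv_X, Pi.single_apply, apply_ite]
      split_ifs <;> simp [add_comm, mul_comm]

theorem exists_ne_zero_aeval_eq_zero {ι κ K : Type*} [Fintype ι] [Fintype κ] [Field K]
    (h : Fintype.card ι < Fintype.card κ) (q : κ → MvPolynomial ι K) :
    ∃ Q : MvPolynomial κ K, Q ≠ 0 ∧ aeval q Q = 0 := by
  by_contra! hcon
  have hind : AlgebraicIndependent K q := by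
    rw [algebraicIndependent_iff]
    intro Q hQ
    by_contra h0
    exact hcon Q h0 hQ
  have h1 := hind.lift_cardinalMk_le_trdeg
  rw [MvPolynomial.trdeg_of_isDomain] at h1
  simp only [Cardinal.mk_fintype, Cardinal.lift_natCast, Nat.cast_le] at h1
  omega

open Filter Topology in
/-- For generic levels `c`, no point is close to more than `card ι` of the hypersurfaces
`q i = c i`. -/
theorem exists_levels_card_close_le {ι κ : Type*} [Fintype ι] [Fintype κ]
    (q : κ → MvPolynomial ι ℝ) {ε : ℝ} (hε : 0 < ε) :
    ∃ c : κ → ℝ, (∀ i, c i ∈ Set.Ioo 0 ε) ∧ ∃ δ > 0, ∀ x : ι → ℝ,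
      (Finset.univ.filter fun i => |eval x (q i) - c i| < δ).card ≤ Fintype.card ι := by
  classical
  set n := Fintype.card ι with hn
  have hex (S : Finset κ) (hS : S ∈ Finset.univ.powersetCard (n + 1)) :
      ∃ Q : MvPolynomial S ℝ, Q ≠ 0 ∧ aeval (fun i : S => q i) Q = 0 :=
    exists_ne_zero_aeval_eq_zero
      (by rw [Fintype.card_coe, (Finset.mem_powersetCard.1 hS).2]; omega) _
  choose! Q hQ0 hQ using hex
  have hprod : ∏ S ∈ Finset.univ.powersetCard (n + 1),
      rename (Subtype.val : S → κ) (Q S) ≠ 0 := by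
    refine Finset.prod_ne_zero_iff.2 fun S hS => ?_
    rw [Ne, map_eq_zero_iff _ (rename_injective _ Subtype.val_injective)]
    exact hQ0 S hS
  obtain ⟨c, hc, hcQ⟩ : ∃ c ∈ Set.pi Set.univ fun _ : κ => Set.Ioo 0 ε,
      eval c (∏ S ∈ Finset.univ.powersetCard (n + 1), rename (Subtype.val : S → κ) (Q S)) ≠ 0 := by
    by_contra! hcon
    exact hprod (funext_set _ (fun _ => Set.Ioo_infinite hε) fun x hx => by
      rw [hcon x hx, map_zero])
  refine ⟨c, fun i => hc i trivial, ?_⟩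
  rw [map_prod, Finset.prod_ne_zero_iff] at hcQ
  have hev : ∀ᶠ δ in 𝓝[>] (0 : ℝ), ∀ S ∈ Finset.univ.powersetCard (n + 1), ∀ x : ι → ℝ,
      ¬ ∀ i ∈ S, |eval x (q i) - c i| < δ := by
    rw [eventually_all_finset]
    intro S hS
    have hne : eval (fun i : S => c i) (Q S) ≠ 0 := by
      have := hcQ S hS
      rwa [eval_rename] at this
    have hcont := (MvPolynomial.continuous_eval (Q S)).continuousAt.eventually_ne hne
    obtain ⟨r, hr, hball⟩ := Metric.eventually_nhds_iff.1 hcont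
    filter_upwards [Ioo_mem_nhdsGT hr] with δ hδ x hx
    refine hball (y := fun i : S => eval x (q i)) ?_ ?_
    · rw [dist_pi_lt_iff hr]
      intro i
      rw [Real.dist_eq]
      exact (hx i i.2).trans hδ.2
    · have h := congrArg (eval x) (hQ S hS)
      rw [map_zero, ← coe_aeval_eq_eval, RingHom.coe_coe, ← AlgHom.comp_apply, comp_aeval] at h
      exact h
  obtain ⟨δ, hδ, hδ0⟩ := (hev.and self_mem_nhdsWithin).exists
  refine ⟨δ, hδ0, fun x => ?_⟩
  by_contra! hcard
  obtain ⟨S, hS, hScard⟩ := Finset.exists_subset_card_eq (Nat.succ_le_of_lt hcard)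
  exact hδ S (Finset.mem_powersetCard.2 ⟨Finset.subset_univ _, hScard⟩) x fun i hi =>
    (Finset.mem_filter.1 (hS hi)).2

open Filter Topology in
/-- Existence of a minimiser of the squared distance to `a` penalised by the squared violations
of the constraints `e i * (c i - q i) ≤ 0`. -/
theorem exists_penalised_minimiser {ι κ : Type*} [Fintype ι] [Fintype κ]
    (q : κ → MvPolynomial ι ℝ) (c e : κ → ℝ) (a : ι → ℝ) {K : ℝ} (hK : 0 ≤ K) :
    ∃ x : ι → ℝ, ∀ y : ι → ℝ,
      ∑ j, (x j - a j) ^ 2 + K * ∑ i, (max 0 (e i * (c i - eval x (q i)))) ^ 2 ≤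
      ∑ j, (y j - a j) ^ 2 + K * ∑ i, (max 0 (e i * (c i - eval y (q i)))) ^ 2 := by
  have hc (i : κ) : Continuous fun x : ι → ℝ => eval x (q i) := MvPolynomial.continuous_eval _
  refine Continuous.exists_forall_le (f := fun x : ι → ℝ =>
    ∑ j, (x j - a j) ^ 2 + K * ∑ i, (max 0 (e i * (c i - eval x (q i)))) ^ 2) (by fun_prop) ?_
  have h1 : Tendsto (fun x : ι → ℝ => ‖x - a‖ ^ 2) (cocompact _) atTop :=
    (tendsto_pow_atTop two_ne_zero).comp
      ((tendsto_norm_cocompact_atTop).comp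
        (Homeomorph.subRight a).isClosedEmbedding.tendsto_cocompact)
  refine tendsto_atTop_mono (fun x => ?_) h1
  have h2 : 0 ≤ K * ∑ i, (max 0 (e i * (c i - eval x (q i)))) ^ 2 := by positivity
  have h3 : ‖x - a‖ ≤ √(∑ j, (x j - a j) ^ 2) := by
    refine (pi_norm_le_iff_of_nonneg (Real.sqrt_nonneg _)).2 fun j => ?_
    refine Real.abs_le_sqrt ?_
    exact Finset.single_le_sum (f := fun j => (x j - a j) ^ 2) (fun _ _ => sq_nonneg _)
      (Finset.mem_univ j)
  have h4 := pow_le_pow_left₀ (norm_nonneg _) h3 2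
  rw [Real.sq_sqrt (by positivity)] at h4
  linarith

open Filter Topology in
/-- At a penalised minimiser, `a` is recovered from the polynomial equations given by the
violated or active constraints. -/
theorem eval_penalty_system_eq {ι κ : Type*} [Fintype ι] [Fintype κ]
    (q : κ → MvPolynomial ι ℝ) (c e : κ → ℝ) (he : ∀ i, e i ^ 2 = 1) (a x : ι → ℝ) {K : ℝ}
    (hK : 0 ≤ K)
    (hx : ∀ y : ι → ℝ,
      ∑ j, (x j - a j) ^ 2 + K * ∑ i, (max 0 (e i * (c i - eval x (q i)))) ^ 2 ≤
      ∑ j, (y j - a j) ^ 2 + K * ∑ i, (max 0 (e i * (c i - eval y (q i)))) ^ 2) (j : ι) :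
    eval x (X j + C K * ∑ i with 0 ≤ e i * (c i - eval x (q i)),
      (q i - C (c i)) * pderiv j (q i)) = a j := by
  classical
  set S := Finset.univ.filter fun i => 0 ≤ e i * (c i - eval x (q i)) with hS
  let G : MvPolynomial ι ℝ :=
    ∑ k, (X k - C (a k)) ^ 2 + C K * ∑ i ∈ S, (q i - C (c i)) ^ 2
  have hG (y : ι → ℝ) : eval y G =
      ∑ k, (y k - a k) ^ 2 + K * ∑ i ∈ S, (eval y (q i) - c i) ^ 2 := by
    simp [G]
  have hle : ∀ᶠ y in 𝓝 x, eval x G ≤ eval y G := by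
    have hneg : ∀ᶠ y in 𝓝 x, ∀ i ∈ Sᶜ, e i * (c i - eval y (q i)) < 0 := by
      rw [eventually_all_finset]
      intro i hi
      have hi' : e i * (c i - eval x (q i)) < 0 := by simpa [hS] using hi
      have hcont : Continuous fun y : ι → ℝ => e i * (c i - eval y (q i)) :=
        continuous_const.mul (continuous_const.sub (MvPolynomial.continuous_eval _))
      exact hcont.continuousAt.eventually_lt_const hi'
    filter_upwards [hneg] with y hy
    have hsq (z : ι → ℝ) (i : κ) : (e i * (c i - eval z (q i))) ^ 2 = (eval z (q i) - c i) ^ 2 := by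
      rw [mul_pow, he, one_mul]; ring
    have h1 : ∑ i, (max 0 (e i * (c i - eval x (q i)))) ^ 2 = ∑ i ∈ S, (eval x (q i) - c i) ^ 2 := by
      rw [← Finset.sum_subset (Finset.subset_univ S)]
      · refine Finset.sum_congr rfl fun i hi => ?_
        rw [max_eq_right (Finset.mem_filter.1 hi).2, hsq]
      · intro i _ hi
        have hi' : e i * (c i - eval x (q i)) < 0 := by simpa [hS] using hi
        rw [max_eq_left hi'.le]; simp
    have h2 : ∑ i, (max 0 (e i * (c i - eval y (q i)))) ^ 2 ≤ ∑ i ∈ S, (eval y (q i) - c i) ^ 2 := by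
      rw [← Finset.sum_subset (Finset.subset_univ S)]
      · refine Finset.sum_le_sum fun i hi => ?_
        rw [← hsq y i, ← sq_abs (e i * _)]
        exact pow_le_pow_left₀ (le_max_left _ _) (max_le (abs_nonneg _) (le_abs_self _)) 2
      · intro i _ hi
        rw [max_eq_left (hy i (Finset.mem_compl.2 hi)).le]; simp
    rw [hG, hG, ← h1]
    exact (hx y).trans (by gcongr)
  have hmin : IsLocalMin (fun t => eval (Function.update x j t) G) (x j) := by
    have hcont : Tendsto (fun t => Function.update x j t) (𝓝 (x j)) (𝓝 x) := by
      have : Continuous fun t => Function.update x j t := continuous_const.update j continuous_id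
      simpa using this.tendsto (x j)
    filter_upwards [hcont.eventually hle] with t ht
    simpa using ht
  have hder := hmin.hasDerivAt_eq_zero (hasDerivAt_eval_update x j G (x j))
  have hpd : pderiv j G = C 2 * (X j + C K * ∑ i ∈ S, (q i - C (c i)) * pderiv j (q i) - C (a j)) := by
    have h1 : pderiv j (∑ k, (X k - C (a k)) ^ 2 : MvPolynomial ι ℝ) = 2 * (X j - C (a j)) := by
      rw [map_sum, Finset.sum_eq_single j]
      · simp [Derivation.leibniz_pow]
      · intro k _ hk
        simp [Derivation.leibniz_pow, pderiv_X_of_ne hk]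
      · simp
    have h2 (i : κ) : pderiv j ((q i - C (c i)) ^ 2) = 2 * ((q i - C (c i)) * pderiv j (q i)) := by
      simp [Derivation.leibniz_pow]
    simp only [G, map_add, h1, pderiv_C_mul, map_sum, h2, ← Finset.mul_sum]
    rw [show (C 2 : MvPolynomial ι ℝ) = 2 from map_ofNat C 2]
    ring
  rw [Function.update_eq_self, hpd, map_mul, eval_C, map_sub, eval_C] at hder
  linarith

theorem sum_filter_card_le_two_pow (κ : Type*) [Fintype κ] (n : ℕ) :
    ∑ S : Finset κ with S.card ≤ n, 2 ^ S.card =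
      ∑ k ∈ Finset.range (n + 1), (Fintype.card κ).choose k * 2 ^ k := by
  classical
  rw [← Finset.sum_fiberwise_of_maps_to (t := Finset.range (n + 1)) (g := Finset.card)
    (fun S hS => Finset.mem_range.2 (Nat.lt_succ_of_le (Finset.mem_filter.1 hS).2))]
  refine Finset.sum_congr rfl fun k hk => ?_
  rw [Finset.sum_congr rfl (g := fun _ => 2 ^ k)
    (fun S hS => by rw [(Finset.mem_filter.1 hS).2]), Finset.sum_const, smul_eq_mul,
    ← Finset.card_univ, ← Finset.card_powersetCard]
  congr 2
  ext S
  simp only [Finset.mem_filter, Finset.mem_univ, true_and, Finset.mem_powersetCard,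
    Finset.subset_univ]
  have := Finset.mem_range.1 hk
  omega

/-- A bound of Warren type for the number of sign patterns of a family of real polynomials. -/
theorem ncard_sign_patterns_le {ι κ : Type*} [Fintype ι] [Fintype κ]
    (q : κ → MvPolynomial ι ℝ) {D : ℕ} (hD : 1 ≤ D) (hq : ∀ i, (q i).totalDegree ≤ D) :
    (Set.range fun (x : ι → ℝ) i => decide (0 < eval x (q i))).ncard ≤
      (∑ k ∈ Finset.range (Fintype.card ι + 1), (Fintype.card κ).choose k * 2 ^ k) *
        (2 * D) ^ Fintype.card ι := by
  classical
  set n := Fintype.card ι with hn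
  let pat : (ι → ℝ) → κ → Bool := fun x i => decide (0 < eval x (q i))
  set P : Finset (κ → Bool) := (Set.range pat).toFinset with hP
  have hwit (σ : κ → Bool) (hσ : σ ∈ P) : ∃ y, pat y = σ := by simpa [hP] using hσ
  choose! y hy using hwit
  obtain ⟨ε, hε0, hε⟩ : ∃ ε > 0, ∀ σ ∈ P, ∀ i, 0 < eval (y σ) (q i) → ε < eval (y σ) (q i) := by
    have hev : ∀ᶠ ε in nhdsWithin (0 : ℝ) (Set.Ioi 0), ∀ σ ∈ P, ∀ i ∈ Finset.univ,
        0 < eval (y σ) (q i) → ε < eval (y σ) (q i) := by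
      simp only [Filter.eventually_all_finset]
      intro σ _ i _
      by_cases h : 0 < eval (y σ) (q i)
      · filter_upwards [Ioo_mem_nhdsGT h] with ε hε _ using hε.2
      · exact Filter.Eventually.of_forall fun _ h' => absurd h' h
    obtain ⟨ε, h1, h2⟩ := (hev.and self_mem_nhdsWithin).exists
    exact ⟨ε, h2, fun σ hσ i => h1 σ hσ i (Finset.mem_univ i)⟩
  obtain ⟨c, hc, δ, hδ, hclose⟩ := exists_levels_card_close_le q hε0
  let e : (κ → Bool) → κ → ℝ := fun σ i => if σ i then 1 else -1
  have he (σ i) : e σ i ^ 2 = 1 := by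
    simp only [e]
    split_ifs <;> norm_num
  have hsat (σ) (hσ : σ ∈ P) (i) : e σ i * (c i - eval (y σ) (q i)) ≤ 0 := by
    have h1 := hε σ hσ i
    have h2 : decide (0 < eval (y σ) (q i)) = σ i := congrFun (hy σ hσ) i
    have h3 := hc i
    rcases hs : σ i with _ | _
    · have h4 : eval (y σ) (q i) ≤ 0 := by simpa [hs] using h2
      simp only [e, hs]
      norm_num
      linarith [h3.1]
    · have h4 : 0 < eval (y σ) (q i) := by simpa [hs] using h2
      simp only [e, hs]
      norm_num
      linarith [h3.2, h1 h4]
  set M : ℝ := ∑ σ ∈ P, ∑ j, (|y σ j| + 1) ^ 2 with hM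
  have hM0 : 0 ≤ M := by positivity
  set K : ℝ := (M + 1) / δ ^ 2 with hK
  have hK0 : 0 < K := by positivity
  let Φ : Finset κ → ι → MvPolynomial ι ℝ := fun S j =>
    X j + C K * ∑ i ∈ S, (q i - C (c i)) * pderiv j (q i)
  have hΦ (S j) : (Φ S j).totalDegree ≤ 2 * D := by
    refine (totalDegree_add _ _).trans (max_le ?_ ?_)
    · rw [totalDegree_X]; omega
    · refine (totalDegree_mul _ _).trans ?_
      rw [totalDegree_C, zero_add]
      refine totalDegree_finsetSum_le fun i _ => (totalDegree_mul _ _).trans ?_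
      rw [two_mul]
      refine Nat.add_le_add ((totalDegree_sub_C_le _ _).trans (hq i))
        ((totalDegree_pderiv_le _ _).trans (hq i))
  choose Q hQ0 hQ using fun S => exists_ne_zero_forall_fiber_card_le (Φ S) (2 * D) (hΦ S)
  obtain ⟨a, ha, haQ⟩ : ∃ a ∈ Set.pi Set.univ fun _ : ι => Set.Ioo (0 : ℝ) 1,
      eval a (∏ S, Q S) ≠ 0 := by
    by_contra! hcon
    exact Finset.prod_ne_zero_iff.2 (fun S _ => hQ0 S)
      (funext_set _ (fun _ => Set.Ioo_infinite one_pos) fun x hx => by rw [hcon x hx, map_zero])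
  rw [map_prod, Finset.prod_ne_zero_iff] at haQ
  choose x hx using fun σ => exists_penalised_minimiser q c (e σ) a hK0.le
  let act : (κ → Bool) → Finset κ := fun σ =>
    Finset.univ.filter fun i => 0 ≤ e σ i * (c i - eval (x σ) (q i))
  have hfib (σ j) : eval (x σ) (Φ (act σ) j) = a j :=
    eval_penalty_system_eq q c (e σ) (he σ) a (x σ) hK0.le (hx σ) j
  have hact (σ) (hσ : σ ∈ P) : (act σ).card ≤ n := by
    refine (Finset.card_le_card fun i hi => ?_).trans (hclose (x σ))
    have hi' := (Finset.mem_filter.1 hi).2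
    have h1 := hx σ (y σ)
    have h2 : ∑ i, (max 0 (e σ i * (c i - eval (y σ) (q i)))) ^ 2 = 0 :=
      Finset.sum_eq_zero fun i _ => by rw [max_eq_left (hsat σ hσ i)]; simp
    have h3 : ∑ j, (y σ j - a j) ^ 2 ≤ M := by
      refine le_trans (Finset.sum_le_sum fun j _ => ?_)
        (Finset.single_le_sum (f := fun σ => ∑ j, (|y σ j| + 1) ^ 2)
          (fun _ _ => by positivity) hσ)
      rw [← sq_abs]
      refine pow_le_pow_left₀ (abs_nonneg _) ((abs_sub _ _).trans ?_) 2
      have := ha j trivial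
      gcongr
      rw [abs_of_pos this.1]
      exact this.2.le
    have h4 : (max 0 (e σ i * (c i - eval (x σ) (q i)))) ^ 2 ≤
        ∑ i, (max 0 (e σ i * (c i - eval (x σ) (q i)))) ^ 2 :=
      Finset.single_le_sum (f := fun i => (max 0 (e σ i * (c i - eval (x σ) (q i)))) ^ 2)
        (fun _ _ => sq_nonneg _) (Finset.mem_univ i)
    rw [max_eq_right hi', mul_pow, he, one_mul] at h4
    rw [h2, mul_zero, add_zero] at h1
    have h5 : 0 ≤ ∑ j, (x σ j - a j) ^ 2 := by positivity
    have h6 : K * (c i - eval (x σ) (q i)) ^ 2 ≤ M := by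
      nlinarith [mul_le_mul_of_nonneg_left h4 hK0.le]
    have h7 : (c i - eval (x σ) (q i)) ^ 2 < δ ^ 2 := by
      rw [hK, div_mul_eq_mul_div, div_le_iff₀ (by positivity)] at h6
      by_contra! h8
      nlinarith [mul_le_mul_of_nonneg_left h8 (by linarith : 0 ≤ M + 1), sq_pos_of_pos hδ]
    simp only [Finset.mem_filter, Finset.mem_univ, true_and]
    rw [abs_sub_comm]
    exact abs_lt_of_sq_lt_sq h7 hδ.le
  have hcount (S : Finset κ) : (P.filter fun σ => act σ = S).card ≤ 2 ^ S.card * (2 * D) ^ n := by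
    set F := P.filter fun σ => act σ = S with hF
    have hFact (σ) (hσ : σ ∈ F) : act σ = S := (Finset.mem_filter.1 hσ).2
    have hinj : Set.InjOn (fun σ => (S.filter fun i => σ i, x σ)) F := by
      intro σ hσ τ hτ h
      rw [Prod.mk.injEq] at h
      obtain ⟨h1, h2⟩ := h
      funext i
      by_cases hi : i ∈ S
      · have := congrArg (fun s => i ∈ s) h1
        simp only [Finset.mem_filter, hi, true_and, eq_iff_iff] at this
        exact Bool.eq_iff_iff.2 this
      · have hσi : ¬ 0 ≤ e σ i * (c i - eval (x σ) (q i)) := fun h => hi <| by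
          rw [← hFact σ hσ]; exact Finset.mem_filter.2 ⟨Finset.mem_univ i, h⟩
        have hτi : ¬ 0 ≤ e τ i * (c i - eval (x τ) (q i)) := fun h => hi <| by
          rw [← hFact τ hτ]; exact Finset.mem_filter.2 ⟨Finset.mem_univ i, h⟩
        rw [← h2] at hτi
        rcases hs : σ i <;> rcases ht : τ i <;> simp [e, hs, ht] at hσi hτi ⊢ <;> linarith
    have hmaps : ∀ σ ∈ F, (S.filter fun i => σ i, x σ) ∈ S.powerset ×ˢ F.image x := fun σ hσ =>
      Finset.mem_product.2 ⟨Finset.mem_powerset.2 (Finset.filter_subset _ _),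
        Finset.mem_image_of_mem _ hσ⟩
    refine (Finset.card_le_card_of_injOn _ hmaps hinj).trans ?_
    rw [Finset.card_product, Finset.card_powerset]
    refine Nat.mul_le_mul_left _ (hQ S a (haQ S (Finset.mem_univ S)) _ fun z hz j => ?_)
    obtain ⟨σ, hσ, rfl⟩ := Finset.mem_image.1 hz
    rw [← hFact σ hσ]
    exact hfib σ j
  calc (Set.range pat).ncard = P.card := by rw [hP, Set.ncard_eq_toFinset_card']
    _ = ∑ S : Finset κ with S.card ≤ n, (P.filter fun σ => act σ = S).card :=
        Finset.card_eq_sum_card_fiberwise fun σ hσ =>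
          Finset.mem_coe.2 (Finset.mem_filter.2 ⟨Finset.mem_univ _, hact σ hσ⟩)
    _ ≤ ∑ S : Finset κ with S.card ≤ n, 2 ^ S.card * (2 * D) ^ n :=
        Finset.sum_le_sum fun S _ => hcount S
    _ = _ := by rw [← Finset.sum_mul, sum_filter_card_le_two_pow]

theorem ncard_range_prodMk_le {Θ α β : Type*} [Finite α] [Finite β] (f : Θ → α) (g : Θ → β) (N : ℕ)
    (h : ∀ θ₀, (g '' {θ | f θ = f θ₀}).ncard ≤ N) :
    (Set.range fun θ => (f θ, g θ)).ncard ≤ (Set.range f).ncard * N := by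
  classical
  have := Fintype.ofFinite α
  have := Fintype.ofFinite β
  rw [Set.ncard_eq_toFinset_card', Set.ncard_eq_toFinset_card', mul_comm]
  refine Finset.card_le_mul_card_image_of_maps_to (f := Prod.fst) (t := (Set.range f).toFinset)
    (fun q hq => ?_) N fun a ha => ?_
  · obtain ⟨θ, rfl⟩ := Set.mem_toFinset.1 hq
    simp
  · obtain ⟨θ₀, rfl⟩ := Set.mem_toFinset.1 ha
    refine le_trans ?_ (h θ₀)
    rw [Set.ncard_eq_toFinset_card']
    refine Finset.card_le_card_of_injOn Prod.snd (fun q hq => ?_) fun q hq r hr hqr => ?_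
    · obtain ⟨hq, hq'⟩ := Finset.mem_filter.1 hq
      obtain ⟨θ, rfl⟩ := Set.mem_toFinset.1 hq
      exact Finset.mem_coe.2 (Set.mem_toFinset.2 ⟨θ, hq', rfl⟩)
    · exact Prod.ext ((Finset.mem_filter.1 hq).2.trans (Finset.mem_filter.1 hr).2.symm) hqr

theorem ncard_range_pi_le {Θ β : Type*} [Finite β] (a : ℕ → Θ → β) (N : ℕ → ℕ) (L : ℕ)
    (h : ∀ k < L, ∀ θ₀, (a k '' {θ | ∀ l < k, a l θ = a l θ₀}).ncard ≤ N k) :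
    (Set.range fun θ (k : Fin L) => a k θ).ncard ≤ ∏ k ∈ Finset.range L, N k := by
  induction L with
  | zero =>
    rw [Finset.prod_range_zero]
    exact Set.ncard_le_one_of_subsingleton _
  | succ L ih =>
    have hsub : (Set.range fun θ (k : Fin (L + 1)) => a k θ) ⊆
        (fun q : (Fin L → β) × β => (Fin.snoc q.1 q.2 : Fin (L + 1) → β)) ''
          Set.range fun θ => ((fun k : Fin L => a k θ), a L θ) := by
      rintro _ ⟨θ, rfl⟩
      refine ⟨_, ⟨θ, rfl⟩, funext fun k => ?_⟩
      refine Fin.lastCases ?_ (fun k => ?_) k <;> simp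
    rw [Finset.prod_range_succ]
    refine (Set.ncard_le_ncard hsub (Set.toFinite _)).trans ?_
    refine (Set.ncard_image_le (Set.toFinite _)).trans ?_
    refine (ncard_range_prodMk_le _ _ (N L) fun θ₀ => ?_).trans
      (Nat.mul_le_mul_right _ (ih fun k hk => h k (hk.trans L.lt_succ_self)))
    convert h L L.lt_succ_self θ₀ using 5 with θ
    exact ⟨fun hθ l hl => congrFun hθ ⟨l, hl⟩, fun hθ => funext fun k => hθ k k.2⟩

/-- The vector of preactivations of layer `k` of the network `nnForward`. -/
noncomputable def nnHidden (d p L : ℕ)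
    (A0 : Fin p → Fin d → ℝ) (b0 : Fin p → ℝ)
    (Ah : Fin (L - 1) → Fin p → Fin p → ℝ) (bh : Fin (L - 1) → Fin p → ℝ)
    (w : Fin d → ℝ) : ℕ → Fin p → ℝ := fun k =>
  Nat.rec (motive := fun _ => Fin p → ℝ)
    (fun i => (∑ j, A0 i j * w j) + b0 i)
    (fun k ih =>
      if hk : k < L - 1 then
        fun i => (∑ j, Ah ⟨k, hk⟩ i j * max (ih j) 0) + bh ⟨k, hk⟩ i
      else ih) k

/-- The preactivations of layer `k` as polynomials in the parameters, for the activation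
pattern `v`. -/
noncomputable def nnHiddenPoly {ι : Type*} (d p L : ℕ)
    (A0 : Fin p → Fin d → MvPolynomial ι ℝ) (b0 : Fin p → MvPolynomial ι ℝ)
    (Ah : Fin (L - 1) → Fin p → Fin p → MvPolynomial ι ℝ)
    (bh : Fin (L - 1) → Fin p → MvPolynomial ι ℝ)
    (w : Fin d → ℝ) (v : ℕ → Fin p → Bool) : ℕ → Fin p → MvPolynomial ι ℝ
  | 0 => fun i => (∑ j, A0 i j * C (w j)) + b0 i
  | k + 1 =>
    if hk : k < L - 1 then
      fun i => (∑ j, Ah ⟨k, hk⟩ i j *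
        (if v k j then nnHiddenPoly d p L A0 b0 Ah bh w v k j else 0)) + bh ⟨k, hk⟩ i
    else nnHiddenPoly d p L A0 b0 Ah bh w v k

theorem totalDegree_sum_mul_add_le {ι τ : Type*} [Fintype τ] {D : ℕ}
    (a h : τ → MvPolynomial ι ℝ) (b : MvPolynomial ι ℝ) (ha : ∀ j, (a j).totalDegree ≤ 1)
    (hh : ∀ j, (h j).totalDegree ≤ D) (hb : b.totalDegree ≤ 1) :
    ((∑ j, a j * h j) + b).totalDegree ≤ D + 1 := by
  refine (totalDegree_add _ _).trans (max_le (totalDegree_finsetSum_le fun j _ => ?_) (by omega))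
  rw [add_comm]
  exact (totalDegree_mul _ _).trans (Nat.add_le_add (ha j) (hh j))

theorem totalDegree_nnHiddenPoly_le {ι : Type*} {d p L : ℕ}
    {A0 : Fin p → Fin d → MvPolynomial ι ℝ} {b0 : Fin p → MvPolynomial ι ℝ}
    {Ah : Fin (L - 1) → Fin p → Fin p → MvPolynomial ι ℝ}
    {bh : Fin (L - 1) → Fin p → MvPolynomial ι ℝ}
    (hA0 : ∀ i j, (A0 i j).totalDegree ≤ 1) (hb0 : ∀ i, (b0 i).totalDegree ≤ 1)
    (hAh : ∀ l i j, (Ah l i j).totalDegree ≤ 1) (hbh : ∀ l i, (bh l i).totalDegree ≤ 1)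
    (w : Fin d → ℝ) (v : ℕ → Fin p → Bool) (k : ℕ) (i : Fin p) :
    (nnHiddenPoly d p L A0 b0 Ah bh w v k i).totalDegree ≤ k + 1 := by
  induction k generalizing i with
  | zero =>
    exact totalDegree_sum_mul_add_le _ _ _ (hA0 i) (fun j => (totalDegree_C _).le) (hb0 i)
  | succ k ih =>
    rw [nnHiddenPoly]
    split_ifs with hk
    · refine totalDegree_sum_mul_add_le _ _ _ (hAh _ i) (fun j => ?_) (hbh _ i)
      split_ifs
      · exact ih j
      · simp
    · exact (ih i).trans (Nat.le_succ _)

theorem eval_nnHiddenPoly {ι : Type*} {d p L : ℕ}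
    (A0 : Fin p → Fin d → MvPolynomial ι ℝ) (b0 : Fin p → MvPolynomial ι ℝ)
    (Ah : Fin (L - 1) → Fin p → Fin p → MvPolynomial ι ℝ)
    (bh : Fin (L - 1) → Fin p → MvPolynomial ι ℝ)
    (w : Fin d → ℝ) (v : ℕ → Fin p → Bool) (θ : ι → ℝ) (k : ℕ)
    (hv : ∀ l < k, ∀ j, v l j = decide (0 < nnHidden d p L (fun i j => eval θ (A0 i j))
      (fun i => eval θ (b0 i)) (fun l i j => eval θ (Ah l i j)) (fun l i => eval θ (bh l i)) w l j))
    (i : Fin p) :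
    eval θ (nnHiddenPoly d p L A0 b0 Ah bh w v k i) =
      nnHidden d p L (fun i j => eval θ (A0 i j)) (fun i => eval θ (b0 i))
        (fun l i j => eval θ (Ah l i j)) (fun l i => eval θ (bh l i)) w k i := by
  induction k generalizing i with
  | zero => simp [nnHiddenPoly, nnHidden]
  | succ k ih =>
    have ih' := ih fun l hl => hv l (hl.trans k.lt_succ_self)
    by_cases hk : k < L - 1
    · simp only [nnHiddenPoly, hk, dif_pos, map_add, map_sum, map_mul]
      conv_rhs => rw [nnHidden]
      simp only [hk, dif_pos]
      congr 1
      refine Finset.sum_congr rfl fun j _ => ?_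
      congr 1
      rw [hv k k.lt_succ_self j, apply_ite (eval θ), ih', map_zero]
      simp only [decide_eq_true_eq]
      split_ifs with h
      · exact (max_eq_left h.le).symm
      · exact (max_eq_right (not_lt.1 h)).symm
    · simp only [nnHiddenPoly, hk, dif_neg, not_false_eq_true]
      rw [ih']
      conv_rhs => rw [nnHidden]
      simp only [hk, dif_neg, not_false_eq_true]
      rfl

/-- The number of dichotomies of a finite set of points of `ℝ^d × ℝ` induced by the subgraphs of
ReLU networks whose weights depend affinely on parameters. -/
theorem ncard_range_subgraph_pattern_le {ι : Type*} [Fintype ι] {d p L : ℕ} (hL : 0 < L)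
    {A0 : Fin p → Fin d → MvPolynomial ι ℝ} {b0 : Fin p → MvPolynomial ι ℝ}
    {Ah : Fin (L - 1) → Fin p → Fin p → MvPolynomial ι ℝ}
    {bh : Fin (L - 1) → Fin p → MvPolynomial ι ℝ}
    {AL : Fin p → MvPolynomial ι ℝ} {bL : MvPolynomial ι ℝ}
    (hA0 : ∀ i j, (A0 i j).totalDegree ≤ 1) (hb0 : ∀ i, (b0 i).totalDegree ≤ 1)
    (hAh : ∀ l i j, (Ah l i j).totalDegree ≤ 1) (hbh : ∀ l i, (bh l i).totalDegree ≤ 1)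
    (hAL : ∀ i, (AL i).totalDegree ≤ 1) (hbL : bL.totalDegree ≤ 1)
    (S : Finset ((Fin d → ℝ) × ℝ)) :
    (Set.range fun (θ : ι → ℝ) (s : S) => decide (s.1.2 < nnForward d p L
      (fun i j => eval θ (A0 i j)) (fun i => eval θ (b0 i)) (fun l i j => eval θ (Ah l i j))
      (fun l i => eval θ (bh l i)) (fun i => eval θ (AL i)) (eval θ bL) s.1.1)).ncard ≤
    (∏ k ∈ Finset.range L, (∑ i ∈ Finset.range (Fintype.card ι + 1),
        (p * S.card).choose i * 2 ^ i) * (2 * (k + 1)) ^ Fintype.card ι) *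
      ((∑ i ∈ Finset.range (Fintype.card ι + 1), S.card.choose i * 2 ^ i) *
        (2 * (L + 1)) ^ Fintype.card ι) := by
  let hid : (ι → ℝ) → (Fin d → ℝ) → ℕ → Fin p → ℝ := fun θ w => nnHidden d p L
    (fun i j => eval θ (A0 i j)) (fun i => eval θ (b0 i)) (fun l i j => eval θ (Ah l i j))
    (fun l i => eval θ (bh l i)) w
  let act : ℕ → (ι → ℝ) → Fin p × S → Bool := fun k θ q => decide (0 < hid θ q.2.1.1 k q.1)
  let out : (ι → ℝ) → S → Bool := fun θ s => decide (s.1.2 < nnForward d p L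
      (fun i j => eval θ (A0 i j)) (fun i => eval θ (b0 i)) (fun l i j => eval θ (Ah l i j))
      (fun l i => eval θ (bh l i)) (fun i => eval θ (AL i)) (eval θ bL) s.1.1)
  let poly : (ι → ℝ) → S → ℕ → Fin p → MvPolynomial ι ℝ := fun θ₀ s =>
    nnHiddenPoly d p L A0 b0 Ah bh s.1.1 fun l j => act l θ₀ (j, s)
  have hpoly (θ₀ θ : ι → ℝ) (k : ℕ) (h : ∀ l < k, act l θ = act l θ₀) (s : S) (i : Fin p) :
      eval θ (poly θ₀ s k i) = hid θ s.1.1 k i :=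
    eval_nnHiddenPoly A0 b0 Ah bh s.1.1 _ θ k
      (fun l hl j => congrFun (h l hl).symm (j, s)) i
  have hdeg (θ₀ s k i) : (poly θ₀ s k i).totalDegree ≤ k + 1 :=
    totalDegree_nnHiddenPoly_le hA0 hb0 hAh hbh _ _ k i
  have hhidden := ncard_range_pi_le act (fun k => (∑ i ∈ Finset.range (Fintype.card ι + 1),
        (p * S.card).choose i * 2 ^ i) * (2 * (k + 1)) ^ Fintype.card ι) L fun k _ θ₀ => by
    have h := ncard_sign_patterns_le (fun q : Fin p × S => poly θ₀ q.2 k q.1) (Nat.succ_pos k)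
      fun q => hdeg θ₀ q.2 k q.1
    rw [Fintype.card_prod, Fintype.card_fin, Fintype.card_coe] at h
    refine (Set.ncard_le_ncard ?_ (Set.toFinite _)).trans h
    rintro _ ⟨θ, hθ, rfl⟩
    exact ⟨θ, funext fun q => congrArg (fun r : ℝ => decide (0 < r)) (hpoly θ₀ θ k hθ q.2 q.1)⟩
  let outPoly : (ι → ℝ) → S → MvPolynomial ι ℝ := fun θ₀ s =>
    ((∑ j, AL j * (if act (L - 1) θ₀ (j, s) then poly θ₀ s (L - 1) j else 0)) + bL) - C s.1.2
  have hdegOut (θ₀ s) : (outPoly θ₀ s).totalDegree ≤ L + 1 := by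
    refine (totalDegree_sub_C_le _ _).trans
      (totalDegree_sum_mul_add_le _ _ _ hAL (fun j => ?_) hbL)
    split_ifs
    · exact (hdeg _ _ _ _).trans (by omega)
    · simp
  have hout (θ₀ θ : ι → ℝ) (h : ∀ l < L, act l θ = act l θ₀) (s : S) :
      decide (0 < eval θ (outPoly θ₀ s)) = out θ s := by
    have hev : eval θ (outPoly θ₀ s) = nnForward d p L
        (fun i j => eval θ (A0 i j)) (fun i => eval θ (b0 i)) (fun l i j => eval θ (Ah l i j))
        (fun l i => eval θ (bh l i)) (fun i => eval θ (AL i)) (eval θ bL) s.1.1 - s.1.2 := by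
      change _ = ((∑ j, eval θ (AL j) * max (hid θ s.1.1 (L - 1) j) 0) + eval θ bL) - s.1.2
      simp only [outPoly, map_sub, map_add, map_sum, map_mul, eval_C]
      congr 2
      refine Finset.sum_congr rfl fun j _ => ?_
      congr 1
      rw [← h (L - 1) (by omega), apply_ite (eval θ),
        hpoly θ₀ θ (L - 1) (fun l hl => h l (by omega)), map_zero]
      simp only [act, decide_eq_true_eq]
      split_ifs with h'
      · exact (max_eq_left h'.le).symm
      · exact (max_eq_right (not_lt.1 h')).symm
    rw [hev]
    simp only [out, sub_pos]
  have hfinal := ncard_range_prodMk_le (fun θ (k : Fin L) => act k θ) out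
    ((∑ i ∈ Finset.range (Fintype.card ι + 1), S.card.choose i * 2 ^ i) *
        (2 * (L + 1)) ^ Fintype.card ι) fun θ₀ => by
    have h := ncard_sign_patterns_le (outPoly θ₀) (Nat.succ_pos L) (hdegOut θ₀)
    rw [Fintype.card_coe] at h
    refine (Set.ncard_le_ncard ?_ (Set.toFinite _)).trans h
    rintro _ ⟨θ, hθ, rfl⟩
    exact ⟨θ, funext fun s => hout θ₀ θ (fun l hl => congrFun hθ ⟨l, hl⟩) s⟩
  refine le_trans ?_ (hfinal.trans (Nat.mul_le_mul_right _ hhidden))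
  refine le_trans (Set.ncard_le_ncard ?_ (Set.toFinite _))
    (Set.ncard_image_le (f := Prod.snd) (Set.toFinite _))
  rintro _ ⟨θ, rfl⟩
  exact ⟨_, ⟨θ, rfl⟩, rfl⟩

theorem sum_choose_mul_two_pow_le {n t : ℕ} (hn : 0 < n) (hnt : n ≤ t) :
    ((∑ i ∈ Finset.range (n + 1), t.choose i * 2 ^ i : ℕ) : ℝ) ≤
      (2 * Real.exp 1 * t / n) ^ n := by
  have hn' : (0 : ℝ) < n := by exact_mod_cast hn
  have ht' : (0 : ℝ) < t := by exact_mod_cast hn.trans_le hnt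
  have hr : (n : ℝ) / t ≤ 1 := (div_le_one ht').2 (by exact_mod_cast hnt)
  have h1 : ∑ i ∈ Finset.range (n + 1), (t.choose i : ℝ) * ((n : ℝ) / t) ^ i ≤ Real.exp 1 ^ n := by
    calc _ ≤ ∑ i ∈ Finset.range (t + 1), (t.choose i : ℝ) * ((n : ℝ) / t) ^ i :=
          Finset.sum_le_sum_of_subset_of_nonneg
            (Finset.range_subset_range.2 (by omega)) fun _ _ _ => by positivity
      _ = ((n : ℝ) / t + 1) ^ t := by
          rw [add_pow]
          exact Finset.sum_congr rfl fun i _ => by rw [one_pow]; ring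
      _ ≤ Real.exp ((n : ℝ) / t) ^ t := pow_le_pow_left₀ (by positivity) (Real.add_one_le_exp _) _
      _ = Real.exp 1 ^ n := by
          rw [← Real.exp_nat_mul, ← Real.exp_nat_mul, mul_div_cancel₀ _ ht'.ne', mul_one]
  have h2 : ((∑ i ∈ Finset.range (n + 1), t.choose i * 2 ^ i : ℕ) : ℝ) ≤
      (2 * (t / n : ℝ)) ^ n *
        ∑ i ∈ Finset.range (n + 1), (t.choose i : ℝ) * ((n : ℝ) / t) ^ i := by
    push_cast
    rw [Finset.mul_sum]
    refine Finset.sum_le_sum fun i hi => ?_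
    have hi' : i ≤ n := Nat.lt_succ_iff.1 (Finset.mem_range.1 hi)
    rw [mul_left_comm]
    refine mul_le_mul_of_nonneg_left ?_ (by positivity)
    have h3 : (2 : ℝ) ^ i ≤ 2 ^ n := pow_le_pow_right₀ one_le_two hi'
    have h4 : 1 ≤ (t / n : ℝ) ^ n * ((n : ℝ) / t) ^ i := by
      rw [← inv_div (t : ℝ) n, inv_pow, ← div_eq_mul_inv, one_le_div (by positivity)]
      exact pow_le_pow_right₀ ((one_le_div hn').2 (by exact_mod_cast hnt)) hi'
    rw [mul_pow, mul_assoc]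
    nlinarith [show (0 : ℝ) < 2 ^ n by positivity]
  calc _ ≤ _ := h2
    _ ≤ (2 * (t / n : ℝ)) ^ n * Real.exp 1 ^ n := by gcongr
    _ = _ := by rw [← mul_pow]; ring

theorem prod_layer_weights_le (p L : ℕ) :
    (∏ k ∈ Finset.range L, (p : ℝ) * (k + 1)) * (L + 1) ≤ ((p : ℝ) * L / 2 + 1) ^ (L + 1) := by
  let z : ℕ → ℝ := fun k => if k < L then (p : ℝ) * (k + 1) else L + 1
  have hz : ∀ k, 0 ≤ z k := fun k => by
    simp only [z]
    split_ifs <;> positivity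
  have hzL (k) (hk : k ∈ Finset.range L) : z k = (p : ℝ) * (k + 1) := if_pos (Finset.mem_range.1 hk)
  have hsum : ∑ k ∈ Finset.range (L + 1), z k = (L + 1) * ((p : ℝ) * L / 2 + 1) := by
    have hgauss : ∑ k ∈ Finset.range L, ((k : ℝ) + 1) = L * (L + 1) / 2 := by
      induction L with
      | zero => simp
      | succ L ih =>
        rw [Finset.sum_range_succ, Finset.sum_range_induction _ (fun n : ℕ => (n : ℝ) * (n + 1) / 2)
          (by simp) L fun k _ => by push_cast; ring]
        push_cast
        ring
    rw [Finset.sum_range_succ, Finset.sum_congr rfl hzL, ← Finset.mul_sum, hgauss,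
      show z L = L + 1 from if_neg (lt_irrefl L)]
    ring
  have h := Real.geom_mean_le_arith_mean (Finset.range (L + 1)) (fun _ => 1) z
    (fun _ _ => zero_le_one) (by simp; positivity) (fun k _ => hz k)
  have hL : (0 : ℝ) < L + 1 := by positivity
  simp only [Real.rpow_one, one_mul, hsum, Finset.sum_const, Finset.card_range, nsmul_eq_mul,
    mul_one, Nat.cast_add, Nat.cast_one] at h
  rw [mul_div_cancel_left₀ _ hL.ne', Real.rpow_inv_le_iff_of_pos
    (Finset.prod_nonneg fun k _ => hz k) (by positivity) hL, Finset.prod_range_succ,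
    Finset.prod_congr rfl hzL, show z L = L + 1 from if_neg (lt_irrefl L)] at h
  exact_mod_cast h

theorem two_mul_mul_lt_two_rpow {u z : ℝ} (hu : 16 ≤ u) (hz : Real.logb 2 (2 * u ^ 2) ≤ z) :
    2 * u * z < 2 ^ z := by
  have hu0 : 0 < u := by linarith
  have hl2 := Real.log_two_gt_d9
  have hl2' : 0 < Real.log 2 := by linarith
  have hxl : Real.logb 2 (2 * u ^ 2) * Real.log 2 = Real.log 2 + 2 * Real.log u := by
    rw [Real.logb, div_mul_cancel₀ _ hl2'.ne', Real.log_mul two_ne_zero (by positivity),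
      Real.log_pow]
    push_cast; ring
  set x := Real.logb 2 (2 * u ^ 2) with hx
  have hlu : Real.log u ≤ 4 * Real.log 2 + (u / 16 - 1) := by
    have h1 := Real.log_le_sub_one_of_pos (show 0 < u / 16 by positivity)
    rw [Real.log_div hu0.ne' (by norm_num), show (16 : ℝ) = 2 ^ 4 by norm_num, Real.log_pow] at h1
    push_cast at h1
    norm_num at h1 ⊢
    linarith
  have hlu1 : 1 ≤ Real.log u := by
    rw [Real.le_log_iff_exp_le hu0]
    linarith [Real.exp_one_lt_d9]
  have hx0 : 0 < x := by
    by_contra! h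
    nlinarith
  have hxu : x < u := by
    by_contra! h
    nlinarith
  have hz0 : 0 < z := hx0.trans_le hz
  have hlz : Real.log z ≤ Real.log x + (z / x - 1) := by
    have h1 := Real.log_le_sub_one_of_pos (show 0 < z / x by positivity)
    rw [Real.log_div hz0.ne' hx0.ne'] at h1
    linarith
  have hzx : z / x - 1 ≤ (z - x) * Real.log 2 := by
    rw [div_sub_one hx0.ne', div_le_iff₀ hx0]
    have : 1 ≤ Real.log 2 * x := by linarith [mul_comm x (Real.log 2)]
    nlinarith [mul_le_mul_of_nonneg_left this (sub_nonneg.2 hz)]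
  have hlxu : Real.log x < Real.log u := Real.log_lt_log hx0 hxu
  rw [← Real.log_lt_log_iff (by positivity) (by positivity), Real.log_rpow two_pos,
    Real.log_mul (by positivity) hz0.ne', Real.log_mul two_ne_zero hu0.ne']
  nlinarith

/-- The numerical step: the number of dichotomies of `m` points is below `2 ^ m` as soon as `m`
exceeds the claimed dimension. -/
theorem dichotomy_bound_lt_two_pow {p L n m : ℕ} (hp : 0 < p) (hL : 0 < L)
    (hm : ((L : ℝ) + 1) * ((n : ℝ) + 1) * Real.logb 2 (2 * (2 * Real.exp 1 * ((L : ℝ) + 1) *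
      ((p : ℝ) * (L : ℝ) / 2 + 1)) ^ 2) < m) :
    (∏ k ∈ Finset.range L, (∑ i ∈ Finset.range (n + 1), (p * m).choose i * 2 ^ i) *
        (2 * (k + 1)) ^ n) *
      ((∑ i ∈ Finset.range (n + 1), m.choose i * 2 ^ i) * (2 * (L + 1)) ^ n) < 2 ^ m := by
  have hp1 : (1 : ℝ) ≤ p := by exact_mod_cast hp
  have hL1 : (1 : ℝ) ≤ L := by exact_mod_cast hL
  have hn0 : (0 : ℝ) ≤ n := by positivity
  set B : ℝ := (p : ℝ) * L / 2 + 1 with hB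
  set u : ℝ := 2 * Real.exp 1 * ((L : ℝ) + 1) * B with hu
  have hpL : 1 ≤ (p : ℝ) * L := by nlinarith
  have hB1 : 3 / 2 ≤ B := by rw [hB]; linarith
  have hu16 : 16 ≤ u := by
    have h1 := Real.exp_one_gt_d9
    have h2 : 3 ≤ (L + 1) * B := by nlinarith
    rw [hu, mul_assoc]
    nlinarith
  set x := Real.logb 2 (2 * u ^ 2) with hx
  have hx1 : 1 ≤ x := by
    rw [hx, Real.le_logb_iff_rpow_le one_lt_two (by positivity), Real.rpow_one]
    nlinarith
  have hnm : (n : ℝ) + 1 < m := by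
    have h2 : (n : ℝ) + 1 ≤ (L + 1) * (n + 1) := le_mul_of_one_le_left (by positivity) (by linarith)
    exact (h2.trans (le_mul_of_one_le_right (by positivity) hx1)).trans_lt hm
  rcases Nat.eq_zero_or_pos n with rfl | hn
  · have : 0 < m := by
      have : (0 : ℝ) < m := by linarith
      exact_mod_cast this
    simpa using Nat.one_lt_two_pow this.ne'
  have hn' : (0 : ℝ) < n := by exact_mod_cast hn
  have hnm' : n ≤ m := by
    have : (n : ℝ) ≤ m := by linarith
    exact_mod_cast this
  set z : ℝ := m / ((L + 1) * n) with hz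
  have hzm : z * ((L + 1) * n) = m := div_mul_cancel₀ _ (by positivity)
  have hxz : x ≤ z := by
    rw [hz, le_div_iff₀ (by positivity)]
    nlinarith
  have hlt := two_mul_mul_lt_two_rpow hu16 hxz
  have h1 := sum_choose_mul_two_pow_le hn hnm'
  have h2 := sum_choose_mul_two_pow_le hn (hnm'.trans (Nat.le_mul_of_pos_left m hp))
  have hbound : (((∏ k ∈ Finset.range L, (∑ i ∈ Finset.range (n + 1), (p * m).choose i * 2 ^ i) *
        (2 * (k + 1)) ^ n) *
      ((∑ i ∈ Finset.range (n + 1), m.choose i * 2 ^ i) * (2 * (L + 1)) ^ n) : ℕ) : ℝ) ≤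
      (2 * u * z) ^ ((L + 1) * n) := by
    rw [Nat.cast_mul, Nat.cast_prod]
    simp only [Nat.cast_mul (Finset.sum _ _)]
    calc _ ≤ (∏ k ∈ Finset.range L, (2 * Real.exp 1 * (p * m : ℕ) / n) ^ n *
            (((2 * (k + 1)) ^ n : ℕ) : ℝ)) *
          ((2 * Real.exp 1 * m / n) ^ n * (((2 * (L + 1)) ^ n : ℕ) : ℝ)) := by
          gcongr
      _ = ((4 * Real.exp 1 * m / n) ^ (L + 1) *
            ((∏ k ∈ Finset.range L, (p : ℝ) * (k + 1)) * (L + 1))) ^ n := by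
          have h3 (k : ℕ) : (2 * Real.exp 1 * (p * m : ℕ) / n) ^ n * (((2 * (k + 1)) ^ n : ℕ) : ℝ) =
              (4 * Real.exp 1 * m / n * (p * (k + 1))) ^ n := by
            push_cast
            rw [← mul_pow]
            ring
          simp only [h3]
          rw [Finset.prod_pow, Finset.prod_mul_distrib, Finset.prod_const, Finset.card_range]
          push_cast
          rw [← mul_pow, ← mul_pow]
          ring
      _ ≤ ((4 * Real.exp 1 * m / n) ^ (L + 1) * B ^ (L + 1)) ^ n := by
          gcongr
          exact prod_layer_weights_le p L
      _ = (2 * u * z) ^ ((L + 1) * n) := by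
          rw [← mul_pow, ← pow_mul]
          congr 1
          rw [hu, hz]
          field_simp
          ring
  have hfinal : (2 * u * z) ^ ((L + 1) * n) < (2 : ℝ) ^ m := by
    have hz0 : 0 < z := by linarith
    calc _ < ((2 : ℝ) ^ z) ^ ((L + 1) * n) :=
          pow_lt_pow_left₀ hlt (by positivity) (by positivity)
      _ = (2 : ℝ) ^ m := by
          rw [← Real.rpow_mul_natCast (by norm_num), ← Real.rpow_natCast 2 m, ← hzm]
          push_cast
          rfl
  exact_mod_cast hbound.trans_lt hfinal

/-- The free parameters of the sparse network. -/
abbrev FreeParam {d p L : ℕ} (mA0 : Fin p → Fin d → Bool) (mb0 : Fin p → Bool)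
    (mAh : Fin (L - 1) → Fin p → Fin p → Bool) (mbh : Fin (L - 1) → Fin p → Bool)
    (mAL : Fin p → Bool) (mbL : Bool) : Type :=
  ((((({q : Fin p × Fin d // mA0 q.1 q.2} ⊕ {i : Fin p // mb0 i}) ⊕
    {q : Fin (L - 1) × Fin p × Fin p // mAh q.1 q.2.1 q.2.2}) ⊕
    {q : Fin (L - 1) × Fin p // mbh q.1 q.2}) ⊕ {i : Fin p // mAL i}) ⊕ {_i : Unit // mbL})

theorem card_freeParam {d p L : ℕ} (mA0 : Fin p → Fin d → Bool) (mb0 : Fin p → Bool)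
    (mAh : Fin (L - 1) → Fin p → Fin p → Bool) (mbh : Fin (L - 1) → Fin p → Bool)
    (mAL : Fin p → Bool) (mbL : Bool) :
    Fintype.card (FreeParam mA0 mb0 mAh mbh mAL mbL) =
      maskZeroNorm d p L mA0 mb0 mAh mbh mAL mbL := by
  simp only [maskZeroNorm, Fintype.card_sum, Fintype.card_subtype]
  congr 1
  cases mbL <;> simp

theorem totalDegree_dite_X_le {ι : Type*} (P : Prop) [Decidable P] (g : P → ι) :
    (if h : P then X (g h) else 0 : MvPolynomial ι ℝ).totalDegree ≤ 1 := by
  split_ifs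
  · exact (totalDegree_X _).le
  · simp

/-- **VC dimension of sparse ReLU networks (Proposition 3, Section 6).**
For `d, L, p ∈ ℕ*` and any sparsity pattern `s` (with `‖s‖₀` nonzero parameters), the
class `S̄_{(L,p,s)}` is VC-subgraph on `[0,1]^d` with dimension at most
`(L+1)(‖s‖₀+1) log₂[2 (2e(L+1)(pL/2+1))²]`. -/
theorem sparse_relu_network_vc_dimension
    (d p L : ℕ) (hd : 0 < d) (hp : 0 < p) (hL : 0 < L)
    (mA0 : Fin p → Fin d → Bool) (mb0 : Fin p → Bool)
    (mAh : Fin (L - 1) → Fin p → Fin p → Bool) (mbh : Fin (L - 1) → Fin p → Bool)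
    (mAL : Fin p → Bool) (mbL : Bool) :
    VCSubgraphLEOn (unitCube d)
      (sparseNNClass d p L Set.univ mA0 mb0 mAh mbh mAL mbL)
      (((L : ℝ) + 1) * ((maskZeroNorm d p L mA0 mb0 mAh mbh mAL mbL : ℝ) + 1) *
        Real.logb 2 (2 * (2 * Real.exp 1 * ((L : ℝ) + 1) *
          ((p : ℝ) * (L : ℝ) / 2 + 1)) ^ 2)) := by
  classical
  intro S _ hS
  by_contra! hcon
  let ι := FreeParam mA0 mb0 mAh mbh mAL mbL
  let A0 : Fin p → Fin d → MvPolynomial ι ℝ := fun i j =>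
    if h : mA0 i j then X (.inl (.inl (.inl (.inl (.inl ⟨(i, j), h⟩))))) else 0
  let b0 : Fin p → MvPolynomial ι ℝ := fun i =>
    if h : mb0 i then X (.inl (.inl (.inl (.inl (.inr ⟨i, h⟩))))) else 0
  let Ah : Fin (L - 1) → Fin p → Fin p → MvPolynomial ι ℝ := fun l i j =>
    if h : mAh l i j then X (.inl (.inl (.inl (.inr ⟨(l, i, j), h⟩)))) else 0
  let bh : Fin (L - 1) → Fin p → MvPolynomial ι ℝ := fun l i =>
    if h : mbh l i then X (.inl (.inl (.inr ⟨(l, i), h⟩))) else 0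
  let AL : Fin p → MvPolynomial ι ℝ := fun i =>
    if h : mAL i then X (.inl (.inr ⟨i, h⟩)) else 0
  let bL : MvPolynomial ι ℝ := if h : mbL then X (.inr ⟨(), h⟩) else 0
  have hcard := ncard_range_subgraph_pattern_le (A0 := A0) (b0 := b0) (Ah := Ah) (bh := bh)
    (AL := AL) (bL := bL) hL (fun _ _ => totalDegree_dite_X_le _ _)
    (fun _ => totalDegree_dite_X_le _ _) (fun _ _ _ => totalDegree_dite_X_le _ _)
    (fun _ _ => totalDegree_dite_X_le _ _) (fun _ => totalDegree_dite_X_le _ _)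
    (totalDegree_dite_X_le _ _) S
  rw [card_freeParam] at hcard
  refine absurd (hcard.trans_lt (dichotomy_bound_lt_two_pow hp hL hS)) (not_lt.2 ?_)
  rw [Function.Surjective.range_eq, Set.ncard_univ, Nat.card_eq_fintype_card, Fintype.card_fun,
    Fintype.card_bool, Fintype.card_coe]
  intro τ
  obtain ⟨f, ⟨A0', b0', Ah', bh', AL', bL', -, -, -, -, -, -, hA0, hb0, hAh, hbh, hAL, hbL, rfl⟩,
    hf⟩ := hcon (S.filter fun s => ∃ h : s ∈ S, τ ⟨s, h⟩ = true) (Finset.filter_subset _ _)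
  let θ : ι → ℝ := Sum.elim (Sum.elim (Sum.elim (Sum.elim (Sum.elim
    (fun q => A0' q.1.1 q.1.2) (fun i => b0' i)) (fun q => Ah' q.1.1 q.1.2.1 q.1.2.2))
    (fun q => bh' q.1.1 q.1.2)) (fun i => AL' i)) (fun _ => bL')
  refine ⟨θ, ?_⟩
  have e1 : (fun i j => eval θ (A0 i j)) = A0' := by
    ext i j
    by_cases h : mA0 i j <;> simp [A0, θ, h, hA0]
  have e2 : (fun i => eval θ (b0 i)) = b0' := by
    ext i
    by_cases h : mb0 i <;> simp [b0, θ, h, hb0]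
  have e3 : (fun l i j => eval θ (Ah l i j)) = Ah' := by
    ext l i j
    by_cases h : mAh l i j <;> simp [Ah, θ, h, hAh]
  have e4 : (fun l i => eval θ (bh l i)) = bh' := by
    ext l i
    by_cases h : mbh l i <;> simp [bh, θ, h, hbh]
  have e5 : (fun i => eval θ (AL i)) = AL' := by
    ext i
    by_cases h : mAL i <;> simp [AL, θ, h, hAL]
  have e6 : eval θ bL = bL' := by
    by_cases h : mbL <;> simp [bL, θ, h, hbL]
  funext s
  beta_reduce
  rw [e1, e2, e3, e4, e5, e6, Bool.eq_iff_iff, decide_eq_true_eq]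
  have h := Set.ext_iff.1 hf s.1
  simp only [Finset.coe_filter, Set.mem_inter_iff, Finset.mem_coe, s.2, true_and,
    Set.mem_ofPred_eq, exists_true_left] at h
  exact h.symm
end

section
/- Neural network weight summability (Lemma 5, Section 6). For d∈ℕ* fixed, and for each L∈ℕ*, p∈ℕ* and s∈{0,1}^{p̄} with p̄ = p²(L−1)+p(L+d+1)+1, define Δ(L,p,s) = ‖s‖₀·log(2e p̄/‖s‖₀) + p + L if ‖s‖₀ ≠ 0, and Δ(L,p,s) = p + L if ‖s‖₀ = 0, where ‖s‖₀ is the number of nonzero components of s. Then Σ_{L∈ℕ*} Σ_{p∈ℕ*} Σ_{s∈{0,1}^{p̄}} e^{−Δ(L,p,s)} ≤ 2. -/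
/-- Total number of parameters of a multilayer ReLU network of depth `L`, width `p`,
input dimension `d`: `p̄ = p²(L−1) + p(L+d+1) + 1`. -/
def nnNumParams (d L p : ℕ) : ℕ := p ^ 2 * (L - 1) + p * (L + d + 1) + 1

/-- The weight `Δ(L,p,s)` assigned to a sparse network model: it equals
`‖s‖₀ log(2e p̄ / ‖s‖₀) + p + L` when `‖s‖₀ ≠ 0` and `p + L` when `‖s‖₀ = 0`,
where `s0 = ‖s‖₀` is the number of nonzero components of the sparsity pattern. -/
noncomputable def nnWeight (d L p s0 : ℕ) : ℝ :=
  if s0 = 0 then (p : ℝ) + L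
  else (s0 : ℝ) * Real.log (2 * Real.exp 1 * (nnNumParams d L p : ℝ) / s0) + p + L

open Finset in
theorem sum_bool_fun_apply_card {M : Type*} [AddCommMonoid M] (N : ℕ) (g : ℕ → M) :
    ∑ s : Fin N → Bool, g (Finset.univ.filter (fun i => s i = true)).card =
      ∑ k ∈ range (N + 1), N.choose k • g k := by
  have h := Finset.sum_powerset_apply_card g (x := (Finset.univ : Finset (Fin N)))
  rw [Finset.card_fin] at h
  rw [← h]
  refine Finset.sum_nbij' (fun s => Finset.univ.filter (fun i => s i = true))
    (fun t i => decide (i ∈ t)) ?_ ?_ ?_ ?_ ?_ <;> intros <;> simp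

theorem choose_mul_div_pow_le (N k : ℕ) (hN : 0 < N) :
    (N.choose k : ℝ) * ((k : ℝ) / (2 * Real.exp 1 * N)) ^ k ≤ (1 / 2) ^ k := by
  have hN' : (0 : ℝ) < N := by exact_mod_cast hN
  have h_choose : (N.choose k : ℝ) ≤ (N : ℝ) ^ k / k.factorial := Nat.choose_le_pow_div k N
  have h_exp := Real.pow_div_factorial_le_exp (k : ℝ) k.cast_nonneg k
  have hk : Real.exp k = Real.exp 1 ^ k := by rw [← Real.exp_nat_mul, mul_one]
  have he := Real.exp_pos 1
  calc (N.choose k : ℝ) * ((k : ℝ) / (2 * Real.exp 1 * N)) ^ k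
      ≤ (N : ℝ) ^ k / k.factorial * ((k : ℝ) / (2 * Real.exp 1 * N)) ^ k := by gcongr
    _ = (k : ℝ) ^ k / k.factorial * (1 / (2 * Real.exp 1)) ^ k := by
        simp only [div_pow, mul_pow, one_pow]
        field_simp
    _ ≤ Real.exp 1 ^ k * (1 / (2 * Real.exp 1)) ^ k := by
        rw [← hk]
        gcongr
    _ = (1 / 2) ^ k := by
        rw [← mul_pow]
        congr 1
        field_simp

theorem exp_neg_nnWeight (d L p k : ℕ) :
    Real.exp (-(nnWeight d L p k)) =
      ((k : ℝ) / (2 * Real.exp 1 * nnNumParams d L p)) ^ k *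
        (Real.exp (-(L : ℝ)) * Real.exp (-(p : ℝ))) := by
  unfold nnWeight
  split_ifs with hk
  · subst hk
    rw [pow_zero, one_mul, ← Real.exp_add]
    congr 1
    ring
  · have hk' : (0 : ℝ) < k := by exact_mod_cast Nat.pos_of_ne_zero hk
    have hN : (0 : ℝ) < nnNumParams d L p := by
      exact_mod_cast Nat.succ_pos _
    have hpos : 0 < (k : ℝ) / (2 * Real.exp 1 * nnNumParams d L p) := by positivity
    rw [← Real.exp_log (pow_pos hpos k), ← Real.exp_add, ← Real.exp_add, Real.log_pow,
      ← inv_div (k : ℝ), Real.log_inv]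
    congr 1
    ring

theorem exp_neg_natCast_le (n : ℕ) : Real.exp (-(n : ℝ)) ≤ (1 / 2) ^ n := by
  have h : Real.exp (-(n : ℝ)) = Real.exp (-1) ^ n := by
    rw [← Real.exp_nat_mul, mul_neg_one]
  rw [h]
  gcongr
  rw [Real.exp_neg, one_div]
  gcongr
  linarith [Real.add_one_le_exp 1]

theorem sum_exp_neg_nnWeight_le (d L p : ℕ) :
    ∑ s : Fin (nnNumParams d L p) → Bool,
      Real.exp (-(nnWeight d L p (Finset.univ.filter (fun i => s i = true)).card)) ≤
      2 * ((1 / 2) ^ L * (1 / 2) ^ p) := by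
  rw [sum_bool_fun_apply_card _ fun k => Real.exp (-(nnWeight d L p k))]
  simp only [exp_neg_nnWeight, nsmul_eq_mul, ← mul_assoc]
  rw [← Finset.sum_mul, ← Finset.sum_mul]
  gcongr
  · calc _ ≤ ∑ k ∈ Finset.range (nnNumParams d L p + 1), (1 / 2 : ℝ) ^ k :=
          Finset.sum_le_sum fun k _ => choose_mul_div_pow_le _ k (Nat.succ_pos _)
      _ ≤ 2 := sum_geometric_two_le _
  · exact exp_neg_natCast_le L
  · exact exp_neg_natCast_le p

theorem hasSum_pnat_half_pow : HasSum (fun n : ℕ+ => (1 / 2 : ℝ) ^ (n : ℕ)) 1 := by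
  rw [← Equiv.pnatEquivNat.symm.hasSum_iff]
  convert hasSum_geometric_two' 1 using 2 with n
  simp [Equiv.pnatEquivNat, pow_succ]
  ring

/-- **Neural network weight summability (Lemma 5, Section 6).**
For a fixed input dimension `d ∈ ℕ*`, summing `e^{−Δ(L,p,s)}` over all depths `L ∈ ℕ*`,
widths `p ∈ ℕ*` and sparsity patterns `s ∈ {0,1}^{p̄}` gives a summable family with
sum at most `2`. -/
theorem neural_network_weight_summability (d : ℕ) (hd : 0 < d) :
    Summable (fun x : (q : ℕ+ × ℕ+) × (Fin (nnNumParams d q.1 q.2) → Bool) =>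
      Real.exp (-(nnWeight d x.1.1 x.1.2
        (Finset.univ.filter (fun i => x.2 i = true)).card))) ∧
    (∑' x : (q : ℕ+ × ℕ+) × (Fin (nnNumParams d q.1 q.2) → Bool),
        Real.exp (-(nnWeight d x.1.1 x.1.2
          (Finset.univ.filter (fun i => x.2 i = true)).card)))
      ≤ 2 := by
  have h_fiber : ∀ q : ℕ+ × ℕ+, _ := fun q => sum_exp_neg_nnWeight_le d q.1 q.2
  have h_bound : HasSum (fun q : ℕ+ × ℕ+ => 2 * ((1 / 2 : ℝ) ^ (q.1 : ℕ) * (1 / 2) ^ (q.2 : ℕ)))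
      2 := by
    have h := (hasSum_pnat_half_pow.mul hasSum_pnat_half_pow
      (hasSum_pnat_half_pow.summable.mul_of_nonneg hasSum_pnat_half_pow.summable
        (fun _ => by positivity) (fun _ => by positivity))).mul_left 2
    simpa using h
  have h_summable : Summable (fun q : ℕ+ × ℕ+ => ∑ s : Fin (nnNumParams d q.1 q.2) → Bool,
      Real.exp (-(nnWeight d q.1 q.2 (Finset.univ.filter (fun i => s i = true)).card))) :=
    h_bound.summable.of_nonneg_of_le
      (fun _ => Finset.sum_nonneg fun _ _ => (Real.exp_pos _).le) h_fiber
  have h_sigma : Summable (fun x : (q : ℕ+ × ℕ+) × (Fin (nnNumParams d q.1 q.2) → Bool) =>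
      Real.exp (-(nnWeight d x.1.1 x.1.2
        (Finset.univ.filter (fun i => x.2 i = true)).card))) := by
    refine (summable_sigma_of_nonneg fun _ => (Real.exp_pos _).le).2
      ⟨fun _ => Summable.of_finite, ?_⟩
    simpa only [tsum_fintype] using h_summable
  refine ⟨h_sigma, ?_⟩
  rw [h_sigma.tsum_sigma]
  simp only [tsum_fintype]
  exact (h_summable.tsum_le_tsum h_fiber h_bound.summable).trans h_bound.tsum_eq.le
end

section
/- Variable-selection weight summability (Lemma 6, Section 7). Let Ω={1,...,p} for some p∈ℕ*, M = P(Ω) the power set of Ω, and M_o = {{1,...,d} : 1≤d≤p} ∪ {∅}. For each m∈M define Δ(m) = 2log(1+|m|) if m∈M_o and Δ(m) = |m|·log(2ep/|m|) if m∈M∖M_o. Then Σ_{m∈M} e^{−Δ(m)} ≤ 1 + π²/6. -/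
open Classical

/-- The ordered family of subsets `M_o = {{1,…,d} : 1 ≤ d ≤ p} ∪ {∅}`, realized inside
`Fin p` as the sets of the `d` smallest indices for `0 ≤ d ≤ p`. -/
def orderedFamily (p : ℕ) (m : Finset (Fin p)) : Prop :=
  ∃ d ≤ p, m = Finset.univ.filter (fun i : Fin p => (i : ℕ) < d)

/-- The variable-selection weight: `Δ(m) = 2 log(1+|m|)` for `m ∈ M_o` and
`Δ(m) = |m| log(2ep/|m|)` otherwise. -/
noncomputable def varSelWeight (p : ℕ) (m : Finset (Fin p)) : ℝ :=
  if orderedFamily p m then 2 * Real.log (1 + (m.card : ℝ))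
  else (m.card : ℝ) * Real.log (2 * Real.exp 1 * (p : ℝ) / (m.card : ℝ))

theorem orderedFamily_empty (p : ℕ) : orderedFamily p ∅ :=
  ⟨0, Nat.zero_le p, by simp⟩

theorem sum_orderedFamily_le {p : ℕ} {f : ℕ → ℝ} (hf : ∀ k, 0 ≤ f k) :
    ∑ m : Finset (Fin p) with orderedFamily p m, f m.card ≤ ∑ d ∈ Finset.range (p + 1), f d := by
  have hcard {m : Finset (Fin p)} (hm : orderedFamily p m) :
      m = Finset.univ.filter (fun i : Fin p => (i : ℕ) < m.card) := by
    obtain ⟨d, hd, rfl⟩ := hm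
    rw [Fin.card_filter_val_lt, min_eq_right hd]
  rw [← Finset.sum_image (g := fun m : Finset (Fin p) => m.card)]
  · refine Finset.sum_le_sum_of_subset_of_nonneg ?_ fun k _ _ => hf k
    refine Finset.image_subset_iff.2 fun m _ => Finset.mem_range_succ_iff.2 ?_
    simpa using m.card_le_univ
  · intro m hm m' hm' h
    rw [hcard (Finset.mem_filter.1 hm).2, hcard (Finset.mem_filter.1 hm').2]
    exact congrArg (fun k : ℕ => Finset.univ.filter fun i : Fin p => (i : ℕ) < k) h

theorem sum_range_inv_succ_sq_le (n : ℕ) :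
    ∑ d ∈ Finset.range n, 1 / (1 + (d : ℝ)) ^ 2 ≤ Real.pi ^ 2 / 6 := by
  have h := sum_le_hasSum (Finset.range (n + 1)) (fun _ _ => by positivity) hasSum_zeta_two
  rw [Finset.sum_range_succ'] at h
  simpa [add_comm] using h

theorem exp_neg_two_mul_log_one_add (k : ℕ) :
    Real.exp (-(2 * Real.log (1 + (k : ℝ)))) = 1 / (1 + (k : ℝ)) ^ 2 := by
  have hk : (0 : ℝ) < 1 + k := by positivity
  rw [Real.exp_neg, two_mul, Real.exp_add, Real.exp_log hk, one_div, sq]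

theorem choose_mul_exp_neg_le {p k : ℕ} (hp : 0 < p) (hk : 0 < k) :
    (p.choose k : ℝ) * Real.exp (-((k : ℝ) * Real.log (2 * Real.exp 1 * (p : ℝ) / (k : ℝ)))) ≤
      (1 / 2) ^ k := by
  have hp' : (0 : ℝ) < p := by exact_mod_cast hp
  have hk' : (0 : ℝ) < k := by exact_mod_cast hk
  have hexp := Real.pow_div_factorial_le_exp (k : ℝ) hk'.le k
  have hbase : (0 : ℝ) < 2 * Real.exp 1 * p / k := by positivity
  rw [Real.exp_neg, Real.exp_nat_mul, Real.exp_log hbase]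
  calc (p.choose k : ℝ) * ((2 * Real.exp 1 * p / k) ^ k)⁻¹
      ≤ (p : ℝ) ^ k / k.factorial * ((2 * Real.exp 1 * p / k) ^ k)⁻¹ := by
        gcongr
        exact Nat.choose_le_pow_div k p
    _ = (1 / 2) ^ k * ((k : ℝ) ^ k / k.factorial / Real.exp k) := by
        rw [← Real.exp_one_pow k]
        simp only [div_pow, mul_pow, one_pow]
        field_simp
    _ ≤ (1 / 2) ^ k * 1 := by
        gcongr
        exact (div_le_one (Real.exp_pos _)).2 hexp
    _ = (1 / 2) ^ k := mul_one _

theorem sum_not_orderedFamily_le_one {p : ℕ} (hp : 0 < p) :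
    ∑ m : Finset (Fin p) with ¬ orderedFamily p m,
      Real.exp (-((m.card : ℝ) * Real.log (2 * Real.exp 1 * (p : ℝ) / (m.card : ℝ)))) ≤ 1 := by
  set g : ℕ → ℝ := fun k => if k = 0 then 0 else
    Real.exp (-((k : ℝ) * Real.log (2 * Real.exp 1 * (p : ℝ) / (k : ℝ)))) with hg
  have hg_nonneg (k : ℕ) : 0 ≤ g k := by
    simp only [hg]
    split_ifs <;> positivity
  calc _ = ∑ m : Finset (Fin p) with ¬ orderedFamily p m, g m.card := by
        refine Finset.sum_congr rfl fun m hm => ?_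
        have hm0 : m ≠ ∅ := by
          rintro rfl
          exact (Finset.mem_filter.1 hm).2 (orderedFamily_empty p)
        simp [hg, hm0]
    _ ≤ ∑ m : Finset (Fin p), g m.card :=
        Finset.sum_le_sum_of_subset_of_nonneg (Finset.filter_subset _ _)
          fun m _ _ => hg_nonneg m.card
    _ = ∑ k ∈ Finset.range (p + 1), p.choose k * g k := by
        rw [← Finset.powerset_univ, Finset.sum_powerset_apply_card]
        simp
    _ = ∑ k ∈ Finset.range p, p.choose (k + 1) * g (k + 1) := by
        rw [Finset.sum_range_succ']
        simp [hg]
    _ ≤ ∑ k ∈ Finset.range p, (1 / 2 : ℝ) ^ (k + 1) :=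
        Finset.sum_le_sum fun k _ => by
          simpa only [hg, Nat.succ_ne_zero, if_false] using choose_mul_exp_neg_le hp k.succ_pos
    _ = (∑ k ∈ Finset.range p, (1 / 2 : ℝ) ^ k) / 2 := by
        rw [Finset.sum_div]
        exact Finset.sum_congr rfl fun k _ => by ring
    _ ≤ 1 := by linarith [sum_geometric_two_le p]

/-- **Variable-selection weight summability (Lemma 6, Section 7).**
For `Ω = {1,…,p}`, `M = P(Ω)` and the weights `Δ(m)` above,
`∑_{m ∈ M} e^{−Δ(m)} ≤ 1 + π²/6`. -/
theorem variable_selection_weight_summability (p : ℕ) (hp : 0 < p) :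
    ∑ m : Finset (Fin p), Real.exp (-(varSelWeight p m)) ≤ 1 + Real.pi ^ 2 / 6 := by
  rw [← Finset.sum_filter_add_sum_filter_not Finset.univ (orderedFamily p), add_comm]
  refine add_le_add ?_ ?_
  · refine le_of_eq_of_le (Finset.sum_congr rfl fun m hm => ?_) (sum_not_orderedFamily_le_one hp)
    rw [varSelWeight, if_neg (Finset.mem_filter.1 hm).2]
  · calc _ = ∑ m : Finset (Fin p) with orderedFamily p m, 1 / (1 + (m.card : ℝ)) ^ 2 := by
          refine Finset.sum_congr rfl fun m hm => ?_
          rw [varSelWeight, if_pos (Finset.mem_filter.1 hm).2, exp_neg_two_mul_log_one_add]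
      _ ≤ ∑ d ∈ Finset.range (p + 1), 1 / (1 + (d : ℝ)) ^ 2 :=
          sum_orderedFamily_le (f := fun k => 1 / (1 + (k : ℝ)) ^ 2) fun k => by positivity
      _ ≤ Real.pi ^ 2 / 6 := sum_range_inv_succ_sq_le (p + 1)
end

section
/- Exponential-family density classes are VC-subgraph (Proposition, Appendix A). Let {R_γ = r_γ·ν, γ∈I} be a one-parameter exponential family in general form on (Y,𝒴) with densities r_γ(y)=exp(u(γ)T(y)−B(γ)), where I is a nontrivial interval of ℝ, T is a real-valued measurable function on Y not ν-a.e. equal to a constant, u is continuous and strictly monotone on I, and B(γ) = log ∫_Y e^{u(γ)T(y)} dν(y). If Γ̄ is a class of measurable functions from a set W to I that is VC-subgraph with dimension not larger than V ≥ 1, then the class of functions R = {(w,y) ↦ r_{γ(w)}(y) : γ ∈ Γ̄} on W×Y is VC-subgraph with dimension not larger than 9.41·V. -/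
open MeasureTheory

/-- A class `F` of real-valued functions on `X` is VC-subgraph with dimension not larger
than `V`: no finite set of points of `X × ℝ` of cardinality exceeding `V` is shattered by
the open subgraphs `{(x,t) : t < f(x)}`, `f ∈ F`. -/
def VCSubgraphLE {X : Type*} (F : Set (X → ℝ)) (V : ℝ) : Prop :=
  ∀ S : Finset (X × ℝ), (S.card : ℝ) > V →
    ∃ S' ⊆ S, ∀ f ∈ F, (↑S' : Set (X × ℝ)) ≠ (↑S : Set (X × ℝ)) ∩ {q : X × ℝ | q.2 < f q.1}

open ProbabilityTheory in
/-- The cumulant generating function is convex on its natural domain, for any nonzero measure. -/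
lemma convexOn_cgf_integrableExpSet {Y : Type*} [MeasurableSpace Y] (ν : Measure Y) [NeZero ν]
    (T : Y → ℝ) : ConvexOn ℝ (integrableExpSet T ν) (cgf T ν) := by
  refine ⟨convex_integrableExpSet, fun s hs t ht a b ha hb hab => ?_⟩
  have hst := convex_integrableExpSet hs ht ha hb hab
  simp only [smul_eq_mul, integrableExpSet, Set.mem_ofPred_eq] at hs ht hst ⊢
  have normalized : ∀ r, Integrable (fun y => Real.exp (r * T y)) ν →
      ∫ y, Real.exp (r * T y - cgf T ν r) ∂ν = 1 := fun r hr => by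
    have hpos : 0 < ∫ y, Real.exp (r * T y) ∂ν := integral_exp_pos hr
    simp only [Real.exp_sub, integral_div, cgf, mgf]
    rw [Real.exp_log hpos, div_self hpos.ne']
  have integrable_normalized : ∀ r c, Integrable (fun y => Real.exp (r * T y)) ν →
      Integrable (fun y => Real.exp (r * T y - c)) ν := fun r c hr => by
    simpa only [Real.exp_sub] using hr.div_const _
  have hle : ∫ y, Real.exp ((a * s + b * t) * T y - (a * cgf T ν s + b * cgf T ν t)) ∂ν ≤
      ∫ y, (a * Real.exp (s * T y - cgf T ν s) + b * Real.exp (t * T y - cgf T ν t)) ∂ν := by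
    refine integral_mono (integrable_normalized _ _ hst)
      (((integrable_normalized _ _ hs).const_mul a).add
        ((integrable_normalized _ _ ht).const_mul b)) fun y => ?_
    have := convexOn_exp.2 (Set.mem_univ (s * T y - cgf T ν s))
      (Set.mem_univ (t * T y - cgf T ν t)) ha hb hab
    simp only [smul_eq_mul] at this
    convert! this using 2
    ring
  rw [integral_add ((integrable_normalized _ _ hs).const_mul a)
    ((integrable_normalized _ _ ht).const_mul b), integral_const_mul, integral_const_mul,
    normalized s hs, normalized t ht, mul_one, mul_one, hab] at hle
  have hpos : 0 < mgf T ν (a * s + b * t) := integral_exp_pos hst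
  simp only [Real.exp_sub, integral_div] at hle
  rw [div_le_one (Real.exp_pos _)] at hle
  exact (Real.log_le_iff_le_exp hpos).2 hle

lemma ConcaveOn.convex_lt_exp {K : Set ℝ} {f : ℝ → ℝ} (hf : ConcaveOn ℝ K f) (t : ℝ) :
    Convex ℝ {s ∈ K | t < Real.exp (f s)} := by
  rcases le_or_gt t 0 with ht | ht
  · simpa [ht.trans_lt (Real.exp_pos _)] using hf.1
  · simpa only [← Real.log_lt_iff_lt_exp ht] using hf.convex_gt (Real.log t)

/-- On a finite set of reals, membership in `A` depends only on the position relative to at most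
`k` thresholds. -/
def HasThresholds (R : Finset ℝ) (k : ℕ) (A : Set ℝ) : Prop :=
  ∃ P : Finset ℝ, P.card ≤ k ∧
    ∀ x ∈ R, ∀ x' ∈ R, (∀ τ ∈ P, τ < x ↔ τ < x') → (x ∈ A ↔ x' ∈ A)

lemma HasThresholds.union {R : Finset ℝ} {k l : ℕ} {A B : Set ℝ} (hA : HasThresholds R k A)
    (hB : HasThresholds R l B) : HasThresholds R (k + l) (A ∪ B) := by
  obtain ⟨P, hP, hPA⟩ := hA
  obtain ⟨Q, hQ, hQB⟩ := hB
  refine ⟨P ∪ Q, (Finset.card_union_le P Q).trans (add_le_add hP hQ), fun x hx x' hx' h => ?_⟩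
  exact or_congr (hPA x hx x' hx' fun τ hτ => h τ (Finset.mem_union_left _ hτ))
    (hQB x hx x' hx' fun τ hτ => h τ (Finset.mem_union_right _ hτ))

lemma HasThresholds.compl {R : Finset ℝ} {k : ℕ} {A : Set ℝ} (hA : HasThresholds R k A) :
    HasThresholds R k Aᶜ := by
  obtain ⟨P, hP, hPA⟩ := hA
  exact ⟨P, hP, fun x hx x' hx' h => not_congr (hPA x hx x' hx' h)⟩

lemma HasThresholds.diff {R : Finset ℝ} {k l : ℕ} {A B : Set ℝ} (hA : HasThresholds R k A)
    (hB : HasThresholds R l B) : HasThresholds R (k + l) (A \ B) := by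
  simpa [Set.sdiff_eq, Set.compl_union] using (hA.compl.union hB).compl

lemma HasThresholds.congr {R : Finset ℝ} {k : ℕ} {A B : Set ℝ} (hA : HasThresholds R k A)
    (h : ∀ x ∈ R, x ∈ B ↔ x ∈ A) : HasThresholds R k B := by
  obtain ⟨P, hP, hPA⟩ := hA
  exact ⟨P, hP, fun x hx x' hx' hxx' => by rw [h x hx, h x' hx', hPA x hx x' hx' hxx']⟩

lemma hasThresholds_one_of_upward {R : Finset ℝ} {A : Set ℝ}
    (hA : ∀ x ∈ R, ∀ y ∈ R, x ∈ A → x ≤ y → y ∈ A) : HasThresholds R 1 A := by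
  classical
  by_cases hne : (R.filter (· ∉ A)).Nonempty
  · refine ⟨{(R.filter (· ∉ A)).max' hne}, by simp, fun x hx x' hx' h => ?_⟩
    have hmax := Finset.mem_filter.1 (Finset.max'_mem _ hne)
    have key : ∀ y ∈ R, (R.filter (· ∉ A)).max' hne < y ↔ y ∈ A := fun y hy => by
      refine ⟨fun hlt => ?_, fun hyA => ?_⟩
      · by_contra hyA
        exact hlt.not_ge (Finset.le_max' _ _ (Finset.mem_filter.2 ⟨hy, hyA⟩))
      · by_contra hle
        exact hmax.2 (hA y hy _ hmax.1 hyA (not_lt.1 hle))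
    rw [← key x hx, ← key x' hx']
    exact h _ (Finset.mem_singleton_self _)
  · have hall : ∀ x ∈ R, x ∈ A := fun x hx => by
      by_contra hxA
      exact hne ⟨x, Finset.mem_filter.2 ⟨hx, hxA⟩⟩
    exact ⟨∅, by simp, fun x hx x' hx' _ => iff_of_true (hall x hx) (hall x' hx')⟩

/-- An interval is the difference of two upward closed sets. -/
lemma hasThresholds_two_of_between {R : Finset ℝ} {A : Set ℝ}
    (hA : ∀ x ∈ R, ∀ y ∈ R, ∀ z ∈ R, x ∈ A → y ∈ A → x ≤ z → z ≤ y → z ∈ A) :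
    HasThresholds R 2 A := by
  have hlower : HasThresholds R 1 {z | ∃ x ∈ R, x ∈ A ∧ x ≤ z} :=
    hasThresholds_one_of_upward fun _ _ _ _ ⟨x, hx, hxA, hxz⟩ hzz' => ⟨x, hx, hxA, hxz.trans hzz'⟩
  have hupper : HasThresholds R 1 {z | ∀ y ∈ R, y ∈ A → y < z} :=
    hasThresholds_one_of_upward fun _ _ _ _ h hzz' y hy hyA => (h y hy hyA).trans_le hzz'
  refine (hlower.diff hupper).congr fun z hz => ⟨fun hzA => ?_, ?_⟩
  · exact ⟨⟨z, hz, hzA, le_rfl⟩, fun h => lt_irrefl z (h z hz hzA)⟩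
  · rintro ⟨⟨x, hx, hxA, hxz⟩, h⟩
    simp only [Set.mem_ofPred_eq, not_forall, not_lt] at h
    obtain ⟨y, hy, hyA, hzy⟩ := h
    exact hA x hx y hy z hz hxA hyA hxz hzy

lemma Convex.hasThresholds_preimage {R : Finset ℝ} {I K : Set ℝ} {u : ℝ → ℝ} (hK : Convex ℝ K)
    (hu : StrictMonoOn u I ∨ StrictAntiOn u I) (hR : ∀ x ∈ R, x ∈ I) :
    HasThresholds R 2 (u ⁻¹' K) := by
  refine hasThresholds_two_of_between fun x hx y hy z hz hxK hyK hxz hzy => ?_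
  refine hK.segment_subset hxK hyK ?_
  rw [segment_eq_uIcc]
  rcases hu with hu | hu
  · exact Set.mem_uIcc.2 (Or.inl ⟨hu.monotoneOn (hR x hx) (hR z hz) hxz,
      hu.monotoneOn (hR z hz) (hR y hy) hzy⟩)
  · exact Set.mem_uIcc.2 (Or.inr ⟨hu.antitoneOn (hR z hz) (hR y hy) hzy,
      hu.antitoneOn (hR x hx) (hR z hz) hxz⟩)

/-- Sauer's lemma for the subgraphs of a VC-subgraph class. -/
lemma VCSubgraphLE.card_traces_le {W : Type*} [DecidableEq (W × ℝ)] {Γ : Set (W → ℝ)} {V : ℕ}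
    (hVC : VCSubgraphLE Γ (V : ℝ)) (Q : Finset (W × ℝ)) (𝒜 : Finset (Finset (W × ℝ)))
    (h𝒜 : ∀ a ∈ 𝒜, ∃ γ ∈ Γ, ∀ q, q ∈ a ↔ q ∈ Q ∧ q.2 < γ q.1) :
    𝒜.card ≤ ∑ k ∈ Finset.range (V + 1), Q.card.choose k := by
  refine 𝒜.card_le_card_shatterer.trans ?_
  simp_rw [← Finset.card_powersetCard]
  refine (Finset.card_le_card fun s hs => Finset.mem_biUnion.2 ⟨s.card, ?_⟩).trans
    Finset.card_biUnion_le
  rw [Finset.mem_shatterer] at hs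
  have hsQ : s ⊆ Q := by
    obtain ⟨a, ha, hsa⟩ := hs.exists_superset
    obtain ⟨γ, -, hγ⟩ := h𝒜 a ha
    exact fun q hq => ((hγ q).1 (hsa hq)).1
  refine ⟨Finset.mem_range.2 (Nat.lt_succ_of_le ?_), Finset.mem_powersetCard.2 ⟨hsQ, rfl⟩⟩
  by_contra! hcard
  obtain ⟨s', hs's, hs'⟩ := hVC s (by exact_mod_cast hcard)
  obtain ⟨a, ha, rfl⟩ := hs hs's
  obtain ⟨γ, hγΓ, hγ⟩ := h𝒜 a ha
  refine hs' γ hγΓ (Set.ext fun q => ?_)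
  simp only [Finset.coe_inter, Set.mem_inter_iff, Finset.mem_coe, hγ q, Set.mem_ofPred_eq]
  exact and_congr_right fun hq => and_iff_right (hsQ hq)

/-- If every subset of `S` is cut out by conditions `γ (w i) ∈ A i` with `γ` in a VC-subgraph
class, and each `A i` is described by at most `k` thresholds, then `S` satisfies the
Sauer-Shelah inequality for `k * S.card` points. -/
lemma VCSubgraphLE.two_pow_card_le {W ι : Type*} {Γ : Set (W → ℝ)} {V : ℕ}
    (hVC : VCSubgraphLE Γ (V : ℝ)) {I : Set ℝ} (hΓI : ∀ γ ∈ Γ, ∀ w, γ w ∈ I) (k : ℕ)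
    (S : Finset ι) (w : ι → W) (A : ι → Set ℝ)
    (hA : ∀ i ∈ S, ∀ R : Finset ℝ, (∀ x ∈ R, x ∈ I) → HasThresholds R k (A i))
    (hS : ∀ S' ⊆ S, ∃ γ ∈ Γ, ∀ i ∈ S, i ∈ S' ↔ γ (w i) ∈ A i) :
    2 ^ S.card ≤ ∑ j ∈ Finset.range (V + 1), (k * S.card).choose j := by
  classical
  choose! g hgΓ hg using hS
  set R : Finset ℝ := S.powerset.biUnion fun S' => S.image fun i => g S' (w i) with hR
  have mem_R : ∀ S' ⊆ S, ∀ i ∈ S, g S' (w i) ∈ R := fun S' hS' i hi =>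
    Finset.mem_biUnion.2 ⟨S', Finset.mem_powerset.2 hS', Finset.mem_image_of_mem _ hi⟩
  have hRI : ∀ x ∈ R, x ∈ I := fun x hx => by
    simp only [hR, Finset.mem_biUnion, Finset.mem_powerset, Finset.mem_image] at hx
    obtain ⟨S', hS', i, -, rfl⟩ := hx
    exact hΓI _ (hgΓ S' hS') _
  have hAR : ∀ i ∈ S, HasThresholds R k (A i) := fun i hi => hA i hi R hRI
  choose! P hPcard hP using hAR
  set Q : Finset (W × ℝ) := S.biUnion fun i => (P i).image (Prod.mk (w i)) with hQ
  have hQcard : Q.card ≤ k * S.card := by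
    rw [mul_comm]
    exact Finset.card_biUnion_le_card_mul _ _ _ fun i hi => Finset.card_image_le.trans (hPcard i hi)
  set trace : Finset ι → Finset (W × ℝ) := fun S' => Q.filter fun q => q.2 < g S' q.1 with htrace
  have hinj : Set.InjOn trace S.powerset := fun S₁ h₁ S₂ h₂ heq => by
    rw [Finset.mem_coe, Finset.mem_powerset] at h₁ h₂
    have hiff : ∀ i ∈ S, i ∈ S₁ ↔ i ∈ S₂ := fun i hi => by
      rw [hg S₁ h₁ i hi, hg S₂ h₂ i hi]
      refine hP i hi _ (mem_R S₁ h₁ i hi) _ (mem_R S₂ h₂ i hi) fun τ hτ => ?_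
      have hq : (w i, τ) ∈ Q := Finset.mem_biUnion.2 ⟨i, hi, Finset.mem_image_of_mem _ hτ⟩
      simpa [htrace, hq] using Finset.ext_iff.1 heq (w i, τ)
    exact Finset.ext fun i => ⟨fun hi => (hiff i (h₁ hi)).1 hi, fun hi => (hiff i (h₂ hi)).2 hi⟩
  rw [← Finset.card_powerset, ← Finset.card_image_of_injOn hinj]
  refine (hVC.card_traces_le Q _ fun a ha => ?_).trans
    (Finset.sum_le_sum fun j _ => Nat.choose_le_choose j hQcard)
  obtain ⟨S', hS', rfl⟩ := Finset.mem_image.1 ha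
  exact ⟨g S', hgΓ S' (Finset.mem_powerset.1 hS'), fun q => by simp [htrace]⟩

lemma sum_range_choose_le_mul_exp {m V : ℕ} (hV : 1 ≤ V) (hVm : V ≤ m) :
    ∑ j ∈ Finset.range (V + 1), (m.choose j : ℝ) ≤ ((m : ℝ) / V) ^ V * Real.exp V := by
  have hV0 : (0 : ℝ) < V := by exact_mod_cast hV
  have hm0 : (0 : ℝ) < m := by exact_mod_cast hV.trans hVm
  set r : ℝ := V / m with hr
  have hr0 : 0 < r := by positivity
  have hr1 : r ≤ 1 := (div_le_one hm0).2 (by exact_mod_cast hVm)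
  have hinv : ((m : ℝ) / V) ^ V * r ^ V = 1 := by
    rw [← mul_pow, hr]
    field_simp
    simp
  have hsum : (∑ j ∈ Finset.range (V + 1), (m.choose j : ℝ)) * r ^ V ≤ Real.exp V := calc
    _ ≤ ∑ j ∈ Finset.range (V + 1), r ^ j * (m.choose j : ℝ) := by
      rw [Finset.sum_mul]
      refine Finset.sum_le_sum fun j hj => ?_
      rw [mul_comm]
      exact mul_le_mul_of_nonneg_right (pow_le_pow_of_le_one hr0.le hr1
        (Nat.lt_succ_iff.1 (Finset.mem_range.1 hj))) (Nat.cast_nonneg _)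
    _ ≤ ∑ j ∈ Finset.range (m + 1), r ^ j * (m.choose j : ℝ) :=
      Finset.sum_le_sum_of_subset_of_nonneg (Finset.range_mono (by omega))
        fun _ _ _ => by positivity
    _ = (r + 1) ^ m := by simp [add_pow]
    _ ≤ Real.exp r ^ m := pow_le_pow_left₀ (by positivity) (Real.add_one_le_exp r) m
    _ = Real.exp V := by
      rw [← Real.exp_nat_mul, hr]
      congr 1
      field_simp
  calc _ = ((m : ℝ) / V) ^ V * ((∑ j ∈ Finset.range (V + 1), (m.choose j : ℝ)) * r ^ V) := by
        rw [mul_left_comm, hinv, mul_one]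
    _ ≤ _ := by gcongr

lemma sum_range_choose_lt_two_pow {n V : ℕ} (hV : 1 ≤ V) (hn : 9 * V ≤ n) :
    ∑ j ∈ Finset.range (V + 1), (6 * n).choose j < 2 ^ n := by
  have hV0 : (0 : ℝ) < V := by exact_mod_cast hV
  have hn' : 9 * (V : ℝ) ≤ n := by exact_mod_cast hn
  have hx : (n : ℝ) / (9 * V) ≤ Real.exp (n / (9 * V) - 1) := by
    simpa using Real.add_one_le_exp ((n : ℝ) / (9 * V) - 1)
  have hbase : ((6 * n : ℕ) : ℝ) / V ≤ Real.exp (6 * Real.log 2) * Real.exp (n / (9 * V) - 1) := by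
    have h64 : Real.exp (6 * Real.log 2) = 64 := by
      rw [mul_comm, Real.exp_mul, Real.exp_log two_pos]
      norm_num
    calc ((6 * n : ℕ) : ℝ) / V = 54 * (n / (9 * V)) := by
          push_cast
          field_simp
          ring
      _ ≤ _ := by
        rw [h64]
        gcongr
        norm_num
  have hlog : 0.6931471803 < Real.log 2 := Real.log_two_gt_d9
  have hlt : (∑ j ∈ Finset.range (V + 1), ((6 * n).choose j : ℝ)) < 2 ^ n := calc
    _ ≤ (((6 * n : ℕ) : ℝ) / V) ^ V * Real.exp V := sum_range_choose_le_mul_exp hV (by omega)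
    _ ≤ (Real.exp (6 * Real.log 2) * Real.exp (n / (9 * V) - 1)) ^ V * Real.exp V := by gcongr
    _ = Real.exp (6 * Real.log 2 * V + n / 9) := by
      rw [← Real.exp_add, ← Real.exp_nat_mul, ← Real.exp_add]
      congr 1
      field_simp
      ring
    _ < Real.exp (n * Real.log 2) := Real.exp_lt_exp.2 (by nlinarith)
    _ = 2 ^ n := by rw [Real.exp_nat_mul, Real.exp_log two_pos]
  exact_mod_cast hlt

/-- **Exponential-family density classes are VC-subgraph (Proposition, Appendix A).**
Let `{R_γ = r_γ · ν, γ ∈ I}` be a one-parameter exponential family in general form, with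
densities `r_γ(y) = exp(u(γ)T(y) − B(γ))`, where `I` is a nontrivial interval, `T` is
measurable and not `ν`-a.e. constant, `u` is continuous and strictly monotone on `I`, and
`B(γ) = log ∫ e^{u(γ)T(y)} dν(y)`. If `Γ̄` is a VC-subgraph class of functions from `W`
to `I` with dimension at most `V ≥ 1`, then the class
`{(w,y) ↦ r_{γ(w)}(y) : γ ∈ Γ̄}` on `W × Y` is VC-subgraph with dimension at most
`9.41 V`. -/
theorem exponential_family_density_class_vc
    {W Y : Type*} [MeasurableSpace Y]
    (I : Set ℝ) (hIordConn : I.OrdConnected)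
    (hInontrivial : ∃ a b : ℝ, a < b ∧ Set.Icc a b ⊆ I)
    (ν : Measure Y) (T : Y → ℝ) (hT : Measurable T)
    (hTnotconst : ¬ ∃ c : ℝ, T =ᵐ[ν] fun _ => c)
    (u : ℝ → ℝ) (hucont : ContinuousOn u I)
    (humono : StrictMonoOn u I ∨ StrictAntiOn u I)
    (B : ℝ → ℝ) (hB : ∀ γ ∈ I, B γ = Real.log (∫ y, Real.exp (u γ * T y) ∂ν))
    (Γ : Set (W → ℝ)) (hΓI : ∀ γ ∈ Γ, ∀ w, γ w ∈ I)
    (V : ℕ) (hV : 1 ≤ V) (hVC : VCSubgraphLE Γ (V : ℝ)) :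
    VCSubgraphLE
      {F : W × Y → ℝ | ∃ γ ∈ Γ, F = fun z => Real.exp (u (γ z.1) * T z.2 - B (γ z.1))}
      (9.41 * (V : ℝ)) := by
  have : NeZero ν := ⟨fun h => hTnotconst ⟨0, by simp [h, Filter.EventuallyEq]⟩⟩
  intro S hScard
  by_contra! hS
  have hcard : 9 * V ≤ S.card := by
    have hV0 : (0 : ℝ) ≤ V := Nat.cast_nonneg V
    have : ((9 * V : ℕ) : ℝ) ≤ S.card := by
      push_cast
      linarith
    exact_mod_cast this
  refine (sum_range_choose_lt_two_pow hV hcard).not_ge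
    (hVC.two_pow_card_le hΓI 6 S (fun i => i.1.1)
      (fun i => {x | i.2 < Real.exp (u x * T i.1.2 - B x)}) (fun i _ R hR => ?_)
      fun S' hS' => ?_)
  · obtain ⟨⟨w, y⟩, t⟩ := i
    have hdomain : Convex ℝ (ProbabilityTheory.integrableExpSet T ν) :=
      ProbabilityTheory.convex_integrableExpSet
    have hconcave : ConcaveOn ℝ (ProbabilityTheory.integrableExpSet T ν)
        fun s => s * T y - ProbabilityTheory.cgf T ν s :=
      ((LinearMap.mulRight ℝ (T y)).concaveOn hdomain).sub (convexOn_cgf_integrableExpSet ν T)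
    have hlinear : ConcaveOn ℝ Set.univ fun s : ℝ => s * T y :=
      (LinearMap.mulRight ℝ (T y)).concaveOn convex_univ
    refine (((hconcave.convex_lt_exp t).hasThresholds_preimage humono hR).union
      (((hlinear.convex_lt_exp t).hasThresholds_preimage humono hR).diff
        (hdomain.hasThresholds_preimage humono hR))).congr
      fun x hx => ?_
    have hBx : B x = ProbabilityTheory.cgf T ν (u x) := hB x (hR x hx)
    by_cases hint : u x ∈ ProbabilityTheory.integrableExpSet T ν
    · simp [hBx, hint]
    · have : ProbabilityTheory.cgf T ν (u x) = 0 := ProbabilityTheory.cgf_undef hint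
      simp [hBx, hint, this]
  · obtain ⟨F, ⟨γ, hγ, rfl⟩, heq⟩ := hS S' hS'
    refine ⟨γ, hγ, fun i hi => ?_⟩
    simpa [hi] using Set.ext_iff.1 heq i
end
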